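/- arXiv:1209.3627 — 2 statements merged into one kernel-verified Lean document; each statement's English description precedes it below -/
import Mathlib

section
/- Let p ≥ 2 be a prime. Every element of 𝓑₋(p) and every element of 𝓑₊(p) is at least p/3. Moreover, if 𝓑₋(p) is non-empty then min 𝓑₋(p) ≤ p/3 + 4.25 · p^{3/4} · log p, and if 𝓑₊(p) is non-empty then min 𝓑₊(p) ≤ p/3 + 3 · p^{3/4} · log p, where log denotes the natural logarithm. -/
/-- The inverse of `b` modulo `p`, normalized to lie in `[0, p-1]`. -/
def modInv (p b : ℕ) : ℕ := ((b : ZMod p)⁻¹).val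

/-- The set `𝓑₋(p)` of integers `β` with `1 ≤ β ≤ (p-3)/2`, `p ≤ β + 2β̄ + 1` and `β > β̄`. -/
def Bminus (p : ℕ) : Finset ℕ :=
  (Finset.Icc 1 p).filter fun β =>
    2 * β + 3 ≤ p ∧ p ≤ β + 2 * modInv p β + 1 ∧ modInv p β < β

/-- The set `𝓑₊(p)` of integers `β` with `1 ≤ β ≤ (p-3)/2`, `β + β̄ ≥ p` and `β̄ ≤ 2β`. -/
def Bplus (p : ℕ) : Finset ℕ :=
  (Finset.Icc 1 p).filter fun β =>
    2 * β + 3 ≤ p ∧ p ≤ β + modInv p β ∧ modInv p β ≤ 2 * β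

section LaurentSpan

variable (F : Type*) {S : Type*} [Field F] [CommRing S] [Algebra F S]

/-- The span of the Laurent monomials `ξ ^ i * ζ ^ l` of weight `|i| + |l|` at most `w`. -/
def laurentSpan (ξ ζ : Sˣ) (w : ℕ) : Submodule F S :=
  Submodule.span F {s | ∃ i l : ℤ, |i| + |l| ≤ w ∧ s = ((ξ ^ i * ζ ^ l : Sˣ) : S)}

/-- The span of the Laurent monomials `ξ ^ i * ζ ^ l` with `0 ≤ i < Q` and `A ≤ l < B`. -/
def boxSpan (ξ ζ : Sˣ) (Q : ℕ) (A B : ℤ) : Submodule F S :=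
  Submodule.span F ((fun il : ℕ × ℤ => ((ξ ^ il.1 * ζ ^ il.2 : Sˣ) : S)) ''
    (Finset.range Q ×ˢ Finset.Ico A B : Finset (ℕ × ℤ)))

variable {F}

theorem zpow_mul_zpow_mem_laurentSpan {ξ ζ : Sˣ} {w : ℕ} {i l : ℤ} (h : |i| + |l| ≤ w) :
    ((ξ ^ i * ζ ^ l : Sˣ) : S) ∈ laurentSpan F ξ ζ w :=
  Submodule.subset_span ⟨i, l, h, rfl⟩

theorem laurentSpan_mono {ξ ζ : Sˣ} {v w : ℕ} (h : v ≤ w) :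
    laurentSpan F ξ ζ v ≤ laurentSpan F ξ ζ w := by
  refine Submodule.span_mono ?_
  rintro _ ⟨i, l, hil, rfl⟩
  exact ⟨i, l, by omega, rfl⟩

theorem mul_mem_laurentSpan {ξ ζ : Sˣ} {v w : ℕ} {x y : S} (hx : x ∈ laurentSpan F ξ ζ v)
    (hy : y ∈ laurentSpan F ξ ζ w) : x * y ∈ laurentSpan F ξ ζ (v + w) := by
  have h := Submodule.mul_mem_mul hx hy
  rw [laurentSpan, laurentSpan, Submodule.span_mul_span] at h
  refine Submodule.span_mono ?_ h
  rintro _ ⟨_, ⟨i, l, hil, rfl⟩, _, ⟨i', l', hil', rfl⟩, rfl⟩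
  refine ⟨i + i', l + l', ?_, ?_⟩
  · have := abs_add_le i i'
    have := abs_add_le l l'
    push_cast
    linarith
  · simp only [← Units.val_mul, zpow_add]
    congr 1
    exact mul_mul_mul_comm _ _ _ _

theorem pow_mem_laurentSpan {ξ ζ : Sˣ} {v : ℕ} {x : S} (hx : x ∈ laurentSpan F ξ ζ v) (j : ℕ) :
    x ^ j ∈ laurentSpan F ξ ζ (j * v) := by
  induction j with
  | zero =>
    have := zpow_mul_zpow_mem_laurentSpan (F := F) (ξ := ξ) (ζ := ζ) (w := 0 * v)
      (i := 0) (l := 0) (by simp)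
    simpa only [zpow_zero, mul_one, pow_zero, Units.val_one] using this
  | succ j ih =>
    rw [pow_succ, add_mul, one_mul]
    exact mul_mem_laurentSpan ih hx

theorem monomial_mul_mem_boxSpan {ξ ζ : Sˣ} {Q : ℕ} (hζ : ζ ^ Q = ξ ^ Q) {e : ℕ} (he : e < Q)
    {A B l : ℤ} (hA : A ≤ l) (hB : l < B) {y : S} (hy : y ∈ laurentSpan F ξ ζ Q) :
    ((ξ ^ e * ζ ^ l : Sˣ) : S) * y ∈ boxSpan F ξ ζ Q (A - 2 * Q) (B + 2 * Q) := by
  suffices h : laurentSpan F ξ ζ Q ≤ (boxSpan F ξ ζ Q (A - 2 * Q) (B + 2 * Q)).comap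
      (LinearMap.mulLeft F ((ξ ^ e * ζ ^ l : Sˣ) : S)) from h hy
  refine Submodule.span_le.2 ?_
  rintro _ ⟨i', l', hil, rfl⟩
  refine Submodule.subset_span ?_
  have hQ : (0 : ℤ) < Q := by omega
  have h1 := abs_le.1 (show |i'| ≤ Q by have := abs_nonneg l'; linarith)
  have h2 : |l'| + |i'| ≤ Q := by linarith
  have hm := Int.emod_nonneg ((e : ℤ) + i') hQ.ne'
  have hm' := Int.emod_lt_of_pos ((e : ℤ) + i') hQ
  have hd := Int.emod_add_mul_ediv ((e : ℤ) + i') Q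
  set d := ((e : ℤ) + i') / Q
  set r := ((e : ℤ) + i') % Q
  have hd1 : -1 ≤ d := by nlinarith
  have hd2 : d ≤ 1 := by nlinarith
  have hdQ : -(Q : ℤ) ≤ Q * d := by nlinarith
  have hdQ' : (Q : ℤ) * d ≤ Q := by nlinarith
  have h3 := abs_le.1 (show |l'| ≤ Q by have := abs_nonneg i'; linarith)
  simp only [Set.mem_image, Finset.mem_coe, Finset.mem_product, Finset.mem_range,
    Finset.mem_Ico, Prod.exists, LinearMap.mulLeft_apply]
  refine ⟨r.toNat, l + l' + Q * d, ⟨by omega, by omega, by omega⟩, ?_⟩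
  rw [← Units.val_mul]
  congr 1
  have hζ' : ζ ^ ((Q : ℤ) * d) = ξ ^ ((Q : ℤ) * d) := by
    rw [zpow_mul, zpow_mul, zpow_natCast, zpow_natCast, hζ]
  have hr : ξ ^ r.toNat = ξ ^ r := by
    rw [← zpow_natCast, Int.toNat_of_nonneg hm]
  rw [hr, zpow_add, hζ', zpow_add, mul_mul_mul_comm, ← zpow_natCast ξ e,
    ← zpow_add ζ, ← zpow_add ξ (e : ℤ), ← hd, zpow_add ξ]
  simp only [mul_comm, mul_left_comm]

theorem finrank_boxSpan_le (ξ ζ : Sˣ) (Q : ℕ) (A B : ℤ) :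
    Module.finrank F (boxSpan F ξ ζ Q A B) ≤ Q * (B - A).toNat := by
  classical
  rw [boxSpan, ← Finset.coe_image]
  refine (finrank_span_finset_le_card _).trans (Finset.card_image_le.trans ?_)
  simp

instance (ξ ζ : Sˣ) (Q : ℕ) (A B : ℤ) : Module.Finite F (boxSpan F ξ ζ Q A B) :=
  FiniteDimensional.span_of_finite F ((Finset.finite_toSet _).image _)

end LaurentSpan

theorem pow_prime_pow_eq_self {M : Type*} [Monoid M] {a : M} {p : ℕ} (h : a ^ p = a) (i : ℕ) :
    a ^ p ^ i = a := by
  induction i with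
  | zero => simp
  | succ i ih => rw [pow_succ, pow_mul, ih, h]

/-- The absolute trace `∑ φ ^ (p ^ i)` with nilpotent value is of small weight. -/
theorem trace_sub_mem_laurentSpan {F S : Type*} [Field F] [CommRing S] [Algebra F S]
    {p : ℕ} [Fact p.Prime] [CharP S p] (s : ℕ) {a b c : F} (ha : a ^ p = a) (hb : b ^ p = b)
    (hc : c ^ p = c) (ξ : Sˣ)
    (h0 : (∑ i ∈ Finset.range (2 * (s + 1)), (a • (ξ : S) + b • ((ξ⁻¹ : Sˣ) : S)) ^ p ^ i
      - algebraMap F S c) ^ p ^ (s + 1) = 0) :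
    ∑ i ∈ Finset.range (2 * (s + 1)), (a • (ξ : S) + b • ((ξ⁻¹ : Sˣ) : S)) ^ p ^ i
      - algebraMap F S c ∈ laurentSpan F ξ (ξ ^ p ^ (2 * (s + 1))) (p ^ s) := by
  set φ := a • (ξ : S) + b • ((ξ⁻¹ : Sˣ) : S) with hφ
  have hpow (i : ℕ) : φ ^ p ^ i = a • ((ξ ^ p ^ i : Sˣ) : S) + b • (((ξ ^ p ^ i)⁻¹ : Sˣ) : S) := by
    rw [hφ, add_pow_char_pow, smul_pow, smul_pow, pow_prime_pow_eq_self ha,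
      pow_prime_pow_eq_self hb, ← inv_pow, Units.val_pow_eq_pow_val, Units.val_pow_eq_pow_val]
  have key : ∑ i ∈ Finset.range (2 * (s + 1)), φ ^ p ^ i - algebraMap F S c
      = ∑ i ∈ Finset.range (s + 1), φ ^ p ^ i
        - ∑ i ∈ Finset.range (s + 1), φ ^ p ^ (2 * (s + 1) + i) := by
    have h1 := h0
    rw [sub_pow_char_pow, sum_pow_char_pow, ← map_pow, pow_prime_pow_eq_self hc] at h1
    simp only [← pow_mul, ← pow_add] at h1
    have h2 : ∑ i ∈ Finset.range (2 * (s + 1)), φ ^ p ^ (i + (s + 1))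
        = ∑ i ∈ Finset.range (s + 1), φ ^ p ^ (i + (s + 1))
          + ∑ i ∈ Finset.range (s + 1), φ ^ p ^ (2 * (s + 1) + i) := by
      rw [two_mul, Finset.sum_range_add]
      congr 1
      refine Finset.sum_congr rfl fun i _ => ?_
      congr 2
      omega
    have h3 : ∑ i ∈ Finset.range (2 * (s + 1)), φ ^ p ^ i
        = ∑ i ∈ Finset.range (s + 1), φ ^ p ^ i
          + ∑ i ∈ Finset.range (s + 1), φ ^ p ^ (i + (s + 1)) := by
      rw [two_mul, Finset.sum_range_add]
      congr 1
      refine Finset.sum_congr rfl fun i _ => ?_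
      congr 2
      omega
    rw [h2] at h1
    rw [h3]
    linear_combination h1
  have hp : 0 < p := (Fact.out : p.Prime).pos
  rw [key]
  refine Submodule.sub_mem _ (Submodule.sum_mem _ fun i hi => ?_) (Submodule.sum_mem _ fun i hi => ?_)
  all_goals
    have hi' : p ^ i ≤ p ^ s := Nat.pow_le_pow_right hp (by simp at hi; omega)
    rw [hpow]
    refine Submodule.add_mem _ (Submodule.smul_mem _ _ ?_) (Submodule.smul_mem _ _ ?_)
  · have := zpow_mul_zpow_mem_laurentSpan (F := F) (ξ := ξ) (ζ := ξ ^ p ^ (2 * (s + 1)))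
      (w := p ^ s) (i := (p ^ i : ℕ)) (l := 0) (by simpa using mod_cast hi')
    simpa only [zpow_natCast, zpow_zero, mul_one] using this
  · have := zpow_mul_zpow_mem_laurentSpan (F := F) (ξ := ξ) (ζ := ξ ^ p ^ (2 * (s + 1)))
      (w := p ^ s) (i := -(p ^ i : ℕ)) (l := 0) (by simpa using mod_cast hi')
    simpa only [zpow_neg, zpow_natCast, zpow_zero, mul_one] using this
  · have := zpow_mul_zpow_mem_laurentSpan (F := F) (ξ := ξ) (ζ := ξ ^ p ^ (2 * (s + 1)))
      (w := p ^ s) (i := 0) (l := (p ^ i : ℕ)) (by simpa using mod_cast hi')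
    simpa only [zpow_natCast, zpow_zero, one_mul, ← pow_mul, ← pow_add] using this
  · have := zpow_mul_zpow_mem_laurentSpan (F := F) (ξ := ξ) (ζ := ξ ^ p ^ (2 * (s + 1)))
      (w := p ^ s) (i := 0) (l := -(p ^ i : ℕ)) (by simpa using mod_cast hi')
    simpa only [zpow_neg, zpow_natCast, zpow_zero, one_mul, ← pow_mul, ← pow_add] using this

section Stepanov

open Polynomial

theorem sum_smul_ne_zero_of_natDegree_eq {F : Type*} [Field F] {N c : ℕ} {W : ℕ → F[X]}
    (hW : ∀ t < N, W t ≠ 0 ∧ (W t).natDegree = t + c) {y : Fin N → F} (hy : y ≠ 0) :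
    ∑ t, y t • W t ≠ 0 ∧ (∑ t, y t • W t).natDegree < N + c := by
  obtain ⟨t₀, ht₀⟩ := Function.ne_iff.1 hy
  simp only [Pi.zero_apply] at ht₀
  constructor
  · intro h0
    have hdis := degree_sum_eq_of_disjoint (fun t : Fin N => y t • W t) Finset.univ (by
      rintro t ⟨-, ht⟩ u ⟨-, hu⟩ htu hdeg
      refine htu (Fin.ext ?_)
      have hyt : y t ≠ 0 := by rintro h; simp [h] at ht
      have hyu : y u ≠ 0 := by rintro h; simp [h] at hu
      have := natDegree_eq_natDegree hdeg
      rw [natDegree_smul _ hyt, natDegree_smul _ hyu, (hW t t.2).2, (hW u u.2).2] at this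
      omega)
    rw [h0, degree_zero, eq_comm, Finset.sup_eq_bot_iff] at hdis
    have := hdis t₀ (Finset.mem_univ _)
    rw [degree_eq_bot, smul_eq_zero] at this
    exact this.elim ht₀ (hW t₀ t₀.2).1
  · have hN : 0 < N + c := by have := t₀.2; omega
    refine lt_of_le_of_lt (natDegree_sum_le_of_forall_le (n := N + c - 1) _ _ fun t _ => ?_)
      (by omega)
    refine (natDegree_smul_le _ _).trans ?_
    rw [(hW t t.2).2]
    have := t.2
    omega

/-- The polynomial obtained from `∑ i < n, (a X + b / X) ^ (p ^ i) - c` by clearing denominators. -/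
noncomputable def tracePoly {F : Type*} [Field F] (p n : ℕ) (a b c : F) : F[X] :=
  ∑ i ∈ Finset.range (n + 1), (C a * X ^ 2 + C b) ^ p ^ i * X ^ (p ^ n - p ^ i)
    - C c * X ^ p ^ n

theorem natDegree_tracePoly {F : Type*} [Field F] {p : ℕ} (hp : 1 < p) (n : ℕ) {a b c : F}
    (ha : a ≠ 0) : (tracePoly p n a b c).natDegree = 2 * p ^ n := by
  have hdeg2 : (C a * X ^ 2 + C b : F[X]).natDegree = 2 := by compute_degree!
  have h0 : (C a * X ^ 2 + C b : F[X]) ≠ 0 := by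
    intro h; rw [h] at hdeg2; simp at hdeg2
  have hterm (i : ℕ) : ((C a * X ^ 2 + C b : F[X]) ^ p ^ i * X ^ (p ^ n - p ^ i)).natDegree
      = p ^ i * 2 + (p ^ n - p ^ i) := by
    rw [natDegree_mul (pow_ne_zero _ h0) (pow_ne_zero _ X_ne_zero), natDegree_pow, hdeg2,
      natDegree_X_pow]
  have hpn : 0 < p ^ n := by positivity
  rw [tracePoly, Finset.sum_range_succ, add_sub_right_comm]
  have hlast : ((C a * X ^ 2 + C b : F[X]) ^ p ^ n * X ^ (p ^ n - p ^ n)).natDegree = 2 * p ^ n := by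
    rw [hterm]; omega
  rw [natDegree_add_eq_right_of_natDegree_lt, hlast]
  rw [hlast]
  refine lt_of_le_of_lt (natDegree_sub_le_of_le (m := 2 * p ^ n - 1) (n := p ^ n)
    (natDegree_sum_le_of_forall_le _ _ fun i hi => ?_) ?_) ?_
  · rw [hterm]
    have : p ^ i < p ^ n := Nat.pow_lt_pow_right hp (Finset.mem_range.1 hi)
    omega
  · exact natDegree_C_mul_X_pow_le _ _
  · rw [max_lt_iff]; omega

theorem tracePoly_map {F S : Type*} [Field F] [CommRing S] [Algebra F S] (p n : ℕ) (hp : 0 < p)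
    (a b c : F) (ξ : Sˣ) :
    aeval (ξ : S) (tracePoly p n a b c) = (ξ : S) ^ p ^ n *
      (∑ i ∈ Finset.range (n + 1), (a • (ξ : S) + b • ((ξ⁻¹ : Sˣ) : S)) ^ p ^ i
        - algebraMap F S c) := by
  have h1 : algebraMap F S a * (ξ : S) ^ 2 + algebraMap F S b
      = ξ * (a • (ξ : S) + b • ((ξ⁻¹ : Sˣ) : S)) := by
    rw [Algebra.smul_def, Algebra.smul_def]
    have := ξ.mul_inv
    linear_combination (- algebraMap F S b) * this
  simp only [tracePoly, map_sub, map_sum, map_mul, map_pow, map_add, aeval_C, aeval_X, h1, mul_sub,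
    Finset.mul_sum]
  congr 1
  · refine Finset.sum_congr rfl fun i hi => ?_
    have hle : p ^ i ≤ p ^ n := Nat.pow_le_pow_right hp (by simp at hi; omega)
    rw [mul_pow, mul_right_comm, ← pow_add, Nat.add_sub_cancel' hle]
  · ring

set_option maxHeartbeats 1000000 in
/-- Stepanov's bound for the number of `x` with `Tr (a x + b / x) = c`. -/
theorem card_trace_fiber_le {F : Type*} [Field F] [Fintype F] {p : ℕ} [Fact p.Prime] [CharP F p]
    {s : ℕ} (hF : Fintype.card F = p ^ (2 * (s + 1))) {a b c : F} (ha0 : a ≠ 0)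
    (ha : a ^ p = a) (hb : b ^ p = b) (hc : c ^ p = c) (Z : Finset F)
    (hZ : ∀ x ∈ Z, x ≠ 0 ∧
      ∑ i ∈ Finset.range (2 * (s + 1)), (a * x + b * x⁻¹) ^ p ^ i = c) :
    Z.card ≤ p ^ (2 * s + 1) + 11 * p ^ (s + 1) := by
  classical
  rcases Z.eq_empty_or_nonempty with rfl | ⟨x₀, hx₀⟩
  · simp
  have hp : 1 < p := (Fact.out : p.Prime).one_lt
  have hp0 : 0 < p := hp.le
  set Q := p ^ (s + 1) with hQ
  set R := p ^ s with hR
  set r := p ^ (2 * s + 1) with hr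
  set q := p ^ (2 * (s + 1)) with hq
  have hQR : Q = R * p := by rw [hQ, hR, pow_succ]
  have hrQR : r = Q * R := by rw [hr, hQ, hR, ← pow_add]; congr 1; ring
  have hqr : q = r * p := by rw [hq, hr, ← pow_succ]; congr 1
  have hqQ : q = Q * Q := by rw [hq, hQ, ← pow_add]; congr 1; ring
  have hRpos : 0 < R := by positivity
  have hQpos : 0 < Q := by positivity
  have hrpos : 0 < r := by positivity
  have hQ2 : 2 * R ≤ Q := by rw [hQR]; nlinarith
  set D : F[X] := ∏ x ∈ Z, (X - C x) with hD
  have hDmonic : D.Monic := monic_prod_of_monic _ _ fun x _ => monic_X_sub_C x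
  have hDdeg : D.natDegree = Z.card := by simp [hD]
  have hDdvd (P : F[X]) (h : ∀ x ∈ Z, P.eval x = 0) : D ∣ P :=
    Finset.prod_dvd_of_coprime
      (fun x _ y _ hxy => pairwise_coprime_X_sub_C Function.injective_id hxy)
      fun x hx => dvd_iff_isRoot.2 (h x hx)
  let I : Ideal F[X] := Ideal.span {D ^ Q}
  let π : F[X] →ₐ[F] F[X] ⧸ I := Ideal.Quotient.mkₐ F I
  have hπ (P : F[X]) : π P = 0 ↔ D ^ Q ∣ P := by
    rw [Ideal.Quotient.mkₐ_eq_mk, Ideal.Quotient.eq_zero_iff_mem, Ideal.mem_span_singleton]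
  have hnt : Nontrivial (F[X] ⧸ I) := by
    refine Ideal.Quotient.nontrivial_iff.2 ?_
    rw [Ne, Ideal.span_singleton_eq_top]
    intro hu
    have h1 := natDegree_eq_zero_of_isUnit hu
    rw [natDegree_pow, hDdeg] at h1
    have : 0 < Z.card := Finset.card_pos.2 ⟨x₀, hx₀⟩
    have : 0 < Q * Z.card := by positivity
    omega
  have hchar : CharP (F[X] ⧸ I) p := charP_of_injective_algebraMap (algebraMap F _).injective p
  have hnil (P : F[X]) (h : ∀ x ∈ Z, P.eval x = 0) : π P ^ Q = 0 := by
    rw [← map_pow, hπ]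
    exact pow_dvd_pow_of_dvd (hDdvd P h) Q
  have hone : π X ^ ((q - 1) * Q) = 1 := by
    have h := hnil (X ^ (q - 1) - 1) fun x hx => by
      rw [eval_sub, eval_pow, eval_X, eval_one, ← hF, FiniteField.pow_card_sub_one_eq_one _ (hZ x hx).1,
        sub_self]
    rw [map_sub, map_pow, map_one, hQ, sub_pow_char_pow, one_pow, ← pow_mul, sub_eq_zero] at h
    exact h
  have hq1 : 1 < q := by rw [hqQ]; nlinarith
  obtain ⟨ξ, hξ⟩ : IsUnit (π X) := IsUnit.of_pow_eq_one hone (by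
    have := Nat.sub_pos_of_lt hq1
    positivity)
  have hπξ (P : F[X]) : π P = aeval (ξ : F[X] ⧸ I) P := by
    rw [hξ, aeval_algHom_apply, aeval_X_left_apply]
  have hξ1 : ξ ^ ((q - 1) * Q) = 1 := by
    ext
    rw [Units.val_pow_eq_pow_val, hξ, hone, Units.val_one]
  set ζ := ξ ^ q with hζ
  have hζQ : ζ ^ Q = ξ ^ Q := by
    have : q * Q = (q - 1) * Q + Q := by
      rw [Nat.sub_mul, one_mul, Nat.sub_add_cancel]
      nlinarith
    rw [hζ, ← pow_mul, this, pow_add, hξ1, one_mul]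
  set H := tracePoly p (2 * s + 1) a b c with hH
  set h := ∑ i ∈ Finset.range (2 * (s + 1)), (a • (ξ : F[X] ⧸ I) + b • ((ξ⁻¹ : (F[X] ⧸ I)ˣ) : F[X] ⧸ I)) ^ p ^ i
        - algebraMap F (F[X] ⧸ I) c with hh
  have hHh : π H = (ξ : F[X] ⧸ I) ^ r * h := by
    rw [hπξ, hH, tracePoly_map _ _ hp0]
    rfl
  have hhQ : h ^ Q = 0 := by
    have := hnil H fun x hx => by
      have := tracePoly_map p (2 * s + 1) hp0 a b c (Units.mk0 x (hZ x hx).1)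
      simp only [Units.val_mk0, smul_eq_mul, Units.val_inv_eq_inv_val, Algebra.algebraMap_self,
        RingHom.id_apply, coe_aeval_eq_eval] at this
      rw [hH, this]
      have h2 := (hZ x hx).2
      rw [show 2 * (s + 1) = 2 * s + 1 + 1 by ring] at h2
      rw [h2, sub_self, mul_zero]
    rw [hHh, mul_pow] at this
    exact ((ξ.isUnit.pow r).pow Q).mul_right_eq_zero.1 this
  have hhmem : h ∈ laurentSpan F ξ ζ R := trace_sub_mem_laurentSpan s ha hb hc ξ hhQ
  set K := R + 10 with hK
  set N := q * K with hN
  set W : ℕ → F[X] := fun t => X ^ (t % r) * X ^ (q * (t / r / p)) * H ^ (t / r % p)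
    * X ^ (r * (p - 1 - t / r % p)) with hW
  have hHdeg : H.natDegree = 2 * r := natDegree_tracePoly hp _ ha0
  have hH0 : H ≠ 0 := by intro h; rw [h] at hHdeg; simp at hHdeg; omega
  have hWdeg (t : ℕ) (_ : t < N) : W t ≠ 0 ∧ (W t).natDegree = t + r * (p - 1) := by
    have hX (k : ℕ) : (X ^ k : F[X]) ≠ 0 := pow_ne_zero _ X_ne_zero
    have hHk (k : ℕ) : H ^ k ≠ 0 := pow_ne_zero _ hH0
    refine ⟨mul_ne_zero (mul_ne_zero (mul_ne_zero (hX _) (hX _)) (hHk _)) (hX _), ?_⟩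
    rw [hW]
    dsimp only
    rw [natDegree_mul (mul_ne_zero (mul_ne_zero (hX _) (hX _)) (hHk _)) (hX _),
      natDegree_mul (mul_ne_zero (hX _) (hX _)) (hHk _), natDegree_mul (hX _) (hX _),
      natDegree_X_pow, natDegree_X_pow, natDegree_X_pow, natDegree_pow, hHdeg]
    have e1 := Nat.mod_add_div t r
    have e2 := Nat.mod_add_div (t / r) p
    have e3 := Nat.mod_lt (t / r) hp0
    obtain ⟨w, hw⟩ : ∃ w, p - 1 = t / r % p + w := ⟨p - 1 - t / r % p, by omega⟩
    rw [hw, Nat.add_sub_cancel_left, hqr]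
    generalize t / r % p = j at *
    generalize t / r / p = k at *
    generalize t / r = u at *
    generalize t % r = v at *
    rw [← e1, ← e2]
    ring
  have hWmem (t : ℕ) (ht : t < N) : π (W t) ∈ boxSpan F ξ ζ Q ((r * (p - 1) : ℕ) - 2 * Q)
      ((r * (p - 1) + r + K : ℕ) + 2 * Q) := by
    set j := t / r % p
    set k := t / r / p
    have hj : j < p := Nat.mod_lt _ hp0
    have hk : k < K := by
      change t / r / p < K
      rw [Nat.div_div_eq_div_mul, ← hqr]
      exact Nat.div_lt_of_lt_mul ht
    have htr : t % r < r := Nat.mod_lt _ hrpos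
    have hy : h ^ j ∈ laurentSpan F ξ ζ Q :=
      laurentSpan_mono (by rw [hQR, mul_comm]; exact Nat.mul_le_mul_left _ hj.le)
        (pow_mem_laurentSpan hhmem j)
    have hl : r * (p - 1) + Q * (t % r / Q) + k < r * (p - 1) + r + K := by
      have := Nat.mul_div_le (t % r) Q
      omega
    convert monomial_mul_mem_boxSpan hζQ (Nat.mod_lt (t % r) hQpos) (A := (r * (p - 1) : ℕ))
      (B := (r * (p - 1) + r + K : ℕ)) (l := (r * (p - 1) + Q * (t % r / Q) + k : ℕ))
      (Int.ofNat_le.2 (by rw [add_assoc]; exact Nat.le_add_right _ _)) (Int.ofNat_lt.2 hl) hy using 1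
    have hpow (u : ℕ) : ξ ^ (Q * u) = ζ ^ (Q * u) := by rw [pow_mul, pow_mul, hζQ]
    have hunit : ξ ^ (t % r % Q) * ζ ^ (r * (p - 1) + Q * (t % r / Q) + k)
        = ξ ^ (t % r) * ξ ^ (q * k) * ξ ^ (r * j) * ξ ^ (r * (p - 1 - j)) := by
      have e1 : ξ ^ (r * (p - 1)) = ζ ^ (r * (p - 1)) := by rw [hrQR, mul_assoc, hpow]
      have e2 : ξ ^ (t % r) = ξ ^ (t % r % Q) * ζ ^ (Q * (t % r / Q)) := by
        rw [← hpow, ← pow_add, Nat.mod_add_div]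
      rw [mul_assoc (_ * _), ← pow_add ξ (r * j), ← mul_add,
        Nat.add_sub_cancel' (by omega : j ≤ p - 1), pow_mul ξ q, ← hζ, e1, e2, add_assoc,
        pow_add, pow_add, mul_comm (ζ ^ (r * (p - 1)))]
      simp only [mul_assoc]
    rw [zpow_natCast, hunit]
    have hWt : W t = X ^ (t % r) * X ^ (q * k) * H ^ j * X ^ (r * (p - 1 - j)) := rfl
    simp only [hWt, map_mul, map_pow, hHh, ← hξ, Units.val_mul, Units.val_pow_eq_pow_val]
    rw [mul_pow, ← pow_mul]
    ring
  have hlin : ¬ LinearIndependent F (fun t : Fin N =>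
      (⟨π (W t), hWmem t t.2⟩ : boxSpan F ξ ζ Q ((r * (p - 1) : ℕ) - 2 * Q)
      ((r * (p - 1) + r + K : ℕ) + 2 * Q))) := by
    intro hli
    have h1 := hli.fintype_card_le_finrank
    rw [Fintype.card_fin] at h1
    have h2 := h1.trans (finrank_boxSpan_le _ _ _ _ _)
    have h3 : (((r * (p - 1) + r + K : ℕ) : ℤ) + 2 * Q - ((r * (p - 1) : ℕ) - 2 * Q)).toNat
        = r + K + 4 * Q := by omega
    rw [h3, hN, hqQ, mul_assoc] at h2
    have h4 := Nat.le_of_mul_le_mul_left h2 hQpos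
    rw [hK, hrQR, mul_add] at h4
    omega
  rw [Fintype.linearIndependent_iff] at hlin
  push Not at hlin
  obtain ⟨y, hy, t₀, ht₀⟩ := hlin
  obtain ⟨hP0, hPdeg⟩ := sum_smul_ne_zero_of_natDegree_eq hWdeg (y := y)
    (fun h => ht₀ (by rw [h]; rfl))
  have hPπ : π (∑ t, y t • W t) = 0 := by
    have := congrArg Subtype.val hy
    simpa using this
  rw [hπ] at hPπ
  have hle := natDegree_le_of_dvd hPπ hP0
  rw [natDegree_pow, hDdeg] at hle
  have h5 : r * (p - 1) ≤ q := by rw [hqr]; exact Nat.mul_le_mul_left _ (Nat.sub_le _ _)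
  have h6 : Q * Z.card ≤ Q * (Q * (K + 1)) := by
    rw [← mul_assoc, ← hqQ]
    nlinarith
  have h7 := Nat.le_of_mul_le_mul_left h6 hQpos
  rw [hK] at h7
  rw [hrQR]
  nlinarith

end Stepanov

section QuadraticExtension

theorem sum_comp_eq_sum_card_mul {ι κ : Type*} [Fintype ι] [Fintype κ] [DecidableEq κ]
    (g : ι → κ) (f : κ → ℂ) :
    ∑ i, f (g i) = ∑ k, ((Finset.univ.filter fun i => g i = k).card : ℂ) * f k := by
  simp_rw [Finset.card_filter, Nat.cast_sum, Finset.sum_mul]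
  rw [Finset.sum_comm]
  refine Finset.sum_congr rfl fun i _ => ?_
  rw [Finset.sum_eq_single (g i)]
  · simp
  · intro k _ hk
    simp [hk.symm]
  · simp

theorem card_pair_neg {K : Type*} [Field K] [DecidableEq K] (hK : (2 : K) ≠ 0) {d : K}
    (hd : d ≠ 0) : ({d, -d} : Finset K).card = 2 := by
  refine Finset.card_pair fun h => hd ?_
  have : 2 * d = 0 := by linear_combination h
  exact (mul_eq_zero.1 this).resolve_left hK

variable {F E : Type*} [Field F] [Fintype F] [Field E] [Fintype E] [Algebra F E]

theorem algebraMap_trace_eq_add_frobenius (h2 : Module.finrank F E = 2) (z : E) :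
    algebraMap F E (Algebra.trace F E z) = z + FiniteField.frobeniusAlgHom F E z := by
  rw [FiniteField.algebraMap_trace_eq_sum_pow, h2]
  simp [Finset.sum_range_succ]

theorem algebraMap_norm_eq_mul_frobenius (h2 : Module.finrank F E = 2) (z : E) :
    algebraMap F E (Algebra.norm F z) = z * FiniteField.frobeniusAlgHom F E z := by
  rw [FiniteField.algebraMap_norm_eq_prod_pow, h2]
  simp [Finset.prod_range_succ]

theorem frobenius_frobenius (h2 : Module.finrank F E = 2) (z : E) :
    FiniteField.frobeniusAlgHom F E (FiniteField.frobeniusAlgHom F E z) = z := by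
  have : Fintype.card E = Fintype.card F ^ 2 := by rw [Module.card_eq_pow_finrank (K := F), h2]
  simp [← pow_mul, ← pow_two, ← this, FiniteField.pow_card]

variable [DecidableEq F] [DecidableEq E]

theorem card_sqrt_add_card_sqrt (h2 : Module.finrank F E = 2) (hF : ringChar F ≠ 2) (Δ : F) :
    (Finset.univ.filter fun u : F => u ^ 2 = Δ).card
      + (Finset.univ.filter fun w : E => w ^ 2 = algebraMap F E Δ ∧
          FiniteField.frobeniusAlgHom F E w = -w).card = 2 := by
  have h20 : (2 : F) ≠ 0 := Ring.two_ne_zero hF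
  have hinj := (algebraMap F E).injective
  have h20' : (2 : E) ≠ 0 := by
    rw [← map_ofNat (algebraMap F E) 2]
    exact (map_ne_zero _).2 h20
  by_cases h0 : Δ = 0
  · subst h0
    have e1 : (Finset.univ.filter fun u : F => u ^ 2 = 0) = {0} := by
      ext u; simp
    have e2 : (Finset.univ.filter fun w : E => w ^ 2 = algebraMap F E 0 ∧
          FiniteField.frobeniusAlgHom F E w = -w) = {0} := by
      ext u
      simp only [map_zero, Finset.mem_filter, Finset.mem_univ, true_and, Finset.mem_singleton]
      constructor
      · rintro ⟨h, -⟩; simpa using h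
      · rintro rfl; simp
    rw [e1, e2]; rfl
  by_cases hs : IsSquare Δ
  · obtain ⟨d, rfl⟩ := hs
    have hd : d ≠ 0 := by rintro rfl; simp at h0
    have e1 : (Finset.univ.filter fun u : F => u ^ 2 = d * d) = {d, -d} := by
      ext u
      simp only [Finset.mem_filter, Finset.mem_univ, true_and, Finset.mem_insert,
        Finset.mem_singleton, ← sq, sq_eq_sq_iff_eq_or_eq_neg]
    have e2 : (Finset.univ.filter fun w : E => w ^ 2 = algebraMap F E (d * d) ∧
          FiniteField.frobeniusAlgHom F E w = -w) = ∅ := by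
      refine Finset.filter_eq_empty_iff.2 ?_
      rintro w - ⟨hw, hw'⟩
      rw [← sq, map_pow, sq_eq_sq_iff_eq_or_eq_neg] at hw
      have hfix : FiniteField.frobeniusAlgHom F E w = w := by
        rcases hw with rfl | rfl
        · exact AlgHom.commutes _ _
        · rw [map_neg, AlgHom.commutes]
      have hw0 : w ≠ 0 := by
        rintro rfl
        have hd' := (map_ne_zero (algebraMap F E)).2 hd
        rcases hw with h | h
        · exact hd' h.symm
        · exact hd' (neg_eq_zero.1 h.symm)
      rw [hfix] at hw'
      have : 2 * w = 0 := by linear_combination hw'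
      exact (mul_ne_zero h20' hw0) this
    rw [e1, e2, card_pair_neg h20 hd]; rfl
  · have hE : IsSquare (algebraMap F E Δ) := by
      have hE2 : ringChar E ≠ 2 := by
        rwa [← Algebra.ringChar_eq F E]
      have hc : Fintype.card E = Fintype.card F ^ 2 := by
        rw [Module.card_eq_pow_finrank (K := F), h2]
      rw [FiniteField.isSquare_iff hE2 (by simpa using h0), hc]
      obtain ⟨m, hm⟩ := FiniteField.odd_card_of_char_ne_two hF |> Nat.odd_iff.2
      have : Fintype.card F ^ 2 / 2 = (Fintype.card F - 1) * (m + 1) := by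
        rw [hm, Nat.add_sub_cancel]
        have : (2 * m + 1) ^ 2 = 2 * (2 * m * (m + 1)) + 1 := by ring
        omega
      rw [this, pow_mul, ← map_pow, FiniteField.pow_card_sub_one_eq_one _ h0, map_one, one_pow]
    obtain ⟨w₀, hw₀⟩ := hE
    have hw00 : w₀ ≠ 0 := by
      rintro rfl
      simp [h0] at hw₀
    have hfrob : FiniteField.frobeniusAlgHom F E w₀ = -w₀ := by
      have h1 : (FiniteField.frobeniusAlgHom F E w₀) ^ 2 = w₀ ^ 2 := by
        rw [← map_pow, sq, ← hw₀, AlgHom.commutes]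
      refine (sq_eq_sq_iff_eq_or_eq_neg.1 h1).resolve_left fun h => hs ?_
      have ht := algebraMap_trace_eq_add_frobenius (F := F) h2 w₀
      rw [h] at ht
      refine ⟨Algebra.trace F E w₀ / 2, hinj ?_⟩
      rw [hw₀, map_mul, map_div₀, ht, map_ofNat]
      field_simp
      ring
    have e1 : (Finset.univ.filter fun u : F => u ^ 2 = Δ) = ∅ :=
      Finset.filter_eq_empty_iff.2 fun u _ hu => hs ⟨u, by rw [← hu, sq]⟩
    have e2 : (Finset.univ.filter fun w : E => w ^ 2 = algebraMap F E Δ ∧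
          FiniteField.frobeniusAlgHom F E w = -w) = {w₀, -w₀} := by
      ext w
      simp only [Finset.mem_filter, Finset.mem_univ, true_and, Finset.mem_insert,
        Finset.mem_singleton, hw₀, ← sq, sq_eq_sq_iff_eq_or_eq_neg]
      constructor
      · exact fun h => h.1
      · intro h
        refine ⟨h, ?_⟩
        rcases h with rfl | rfl
        · exact hfrob
        · rw [map_neg, hfrob]
    rw [e1, e2, card_pair_neg h20' hw00]; rfl

theorem card_pair_fiber (hF : ringChar F ≠ 2) (s : F) (t : Fˣ) :
    (Finset.univ.filter fun xy : Fˣ × Fˣ => ((xy.1 : F) + xy.2, xy.1 * xy.2) = (s, t)).card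
      = (Finset.univ.filter fun u : F => u ^ 2 = s ^ 2 - 4 * t).card := by
  have h20 : (2 : F) ≠ 0 := Ring.two_ne_zero hF
  refine Finset.card_bij (fun xy _ => (xy.1 : F) - xy.2) ?_ ?_ ?_
  · rintro ⟨x, y⟩ h
    simp only [Finset.mem_filter, Finset.mem_univ, true_and, Prod.mk.injEq] at h ⊢
    rw [← h.1, ← h.2, Units.val_mul]
    ring
  · rintro ⟨x, y⟩ h ⟨x', y'⟩ h' he
    simp only [Finset.mem_filter, Finset.mem_univ, true_and, Prod.mk.injEq] at h h' he ⊢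
    have hx : (x : F) = x' := mul_left_cancel₀ h20 (by linear_combination h.1 - h'.1 + he)
    have hy : (y : F) = y' := mul_left_cancel₀ h20 (by linear_combination h.1 - h'.1 - he)
    exact ⟨Units.ext hx, Units.ext hy⟩
  · intro u hu
    simp only [Finset.mem_filter, Finset.mem_univ, true_and] at hu
    have hprod : ((s + u) / 2) * ((s - u) / 2) = t := by
      field_simp
      linear_combination -hu
    have hx : (s + u) / 2 ≠ 0 := fun h => t.ne_zero (by rw [← hprod, h, zero_mul])
    have hy : (s - u) / 2 ≠ 0 := fun h => t.ne_zero (by rw [← hprod, h, mul_zero])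
    refine ⟨(Units.mk0 _ hx, Units.mk0 _ hy), ?_, ?_⟩
    · simp only [Finset.mem_filter, Finset.mem_univ, true_and, Prod.mk.injEq, Units.val_mk0]
      refine ⟨by field_simp; ring, Units.ext ?_⟩
      rw [Units.val_mul, Units.val_mk0, Units.val_mk0, hprod]
    · simp only [Units.val_mk0]
      field_simp
      ring

theorem card_trace_norm_fiber (h2 : Module.finrank F E = 2) (hF : ringChar F ≠ 2) (s : F)
    (t : Fˣ) :
    (Finset.univ.filter fun z : Eˣ =>
        (Algebra.trace F E (z : E), Units.map (Algebra.norm F) z) = (s, t)).card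
      = (Finset.univ.filter fun w : E => w ^ 2 = algebraMap F E (s ^ 2 - 4 * t) ∧
          FiniteField.frobeniusAlgHom F E w = -w).card := by
  have h20 : (2 : F) ≠ 0 := Ring.two_ne_zero hF
  have hinj := (algebraMap F E).injective
  have h20' : (2 : E) ≠ 0 := by
    rw [← map_ofNat (algebraMap F E) 2]
    exact (map_ne_zero _).2 h20
  have key (z : E) (s t : F) : (Algebra.trace F E z = s ∧ Algebra.norm F z = t) ↔
      (z + FiniteField.frobeniusAlgHom F E z = algebraMap F E s ∧
        z * FiniteField.frobeniusAlgHom F E z = algebraMap F E t) := by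
    rw [← algebraMap_trace_eq_add_frobenius h2, ← algebraMap_norm_eq_mul_frobenius h2,
      hinj.eq_iff, hinj.eq_iff]
  have hmem (z : Eˣ) : z ∈ (Finset.univ.filter fun z : Eˣ =>
        (Algebra.trace F E (z : E), Units.map (Algebra.norm F) z) = (s, t)) ↔
      ((z : E) + FiniteField.frobeniusAlgHom F E z = algebraMap F E s ∧
        z * FiniteField.frobeniusAlgHom F E z = algebraMap F E t) := by
    rw [← key]
    simp only [Finset.mem_filter, Finset.mem_univ, true_and, Prod.mk.injEq, Units.ext_iff,
      Units.coe_map]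
  refine Finset.card_bij (fun z _ => (z : E) - FiniteField.frobeniusAlgHom F E z) ?_ ?_ ?_
  · intro z h
    rw [hmem] at h
    simp only [Finset.mem_filter, Finset.mem_univ, true_and]
    rw [map_sub (FiniteField.frobeniusAlgHom F E), frobenius_frobenius h2]
    refine ⟨?_, by ring⟩
    rw [map_sub, map_pow, map_mul, ← h.1, ← h.2, map_ofNat]
    ring
  · intro z h z' h' he
    rw [hmem] at h h'
    exact Units.ext (mul_left_cancel₀ h20' (by linear_combination h.1 - h'.1 + he))
  · intro w hw
    simp only [Finset.mem_filter, Finset.mem_univ, true_and] at hw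
    obtain ⟨hw, hw'⟩ := hw
    have hσ : FiniteField.frobeniusAlgHom F E ((algebraMap F E s + w) / 2)
        = (algebraMap F E s - w) / 2 := by
      rw [map_div₀, map_add, AlgHom.commutes, hw', map_ofNat, ← sub_eq_add_neg]
    have hprod : ((algebraMap F E s + w) / 2) * ((algebraMap F E s - w) / 2)
        = algebraMap F E t := by
      rw [map_sub, map_pow, map_mul, map_ofNat] at hw
      field_simp
      linear_combination -hw
    have ht : algebraMap F E t ≠ 0 := by simp
    have hx : (algebraMap F E s + w) / 2 ≠ 0 := fun h => ht (by rw [← hprod, h, zero_mul])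
    refine ⟨Units.mk0 _ hx, ?_, ?_⟩
    · rw [hmem]
      simp only [Units.val_mk0]
      rw [hσ]
      exact ⟨by field_simp; ring, hprod⟩
    · simp only [Units.val_mk0]
      rw [hσ]
      field_simp
      ring

theorem sum_quadratic_extension (h2 : Module.finrank F E = 2) (hF : ringChar F ≠ 2)
    {Ψ : AddChar F ℂ} (hΨ : Ψ ≠ 1) {a b : F} (ha : a ≠ 0) (hb : b ≠ 0) :
    ∑ z : Eˣ, Ψ (Algebra.trace F E (algebraMap F E a * z + algebraMap F E b * (z⁻¹ : Eˣ)))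
      = 2 * Fintype.card F - (∑ x : Fˣ, Ψ (a * x + b * (x⁻¹ : Fˣ))) ^ 2 := by
  let f : F × Fˣ → ℂ := fun st => Ψ (st.1 * (a + b * (st.2⁻¹ : Fˣ)))
  have hsq : (∑ x : Fˣ, Ψ (a * x + b * (x⁻¹ : Fˣ))) ^ 2
      = ∑ xy : Fˣ × Fˣ, f ((xy.1 : F) + xy.2, xy.1 * xy.2) := by
    rw [sq, Finset.sum_mul_sum, ← Finset.univ_product_univ, Finset.sum_product]
    refine Finset.sum_congr rfl fun x _ => Finset.sum_congr rfl fun y _ => ?_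
    rw [← AddChar.map_add_eq_mul]
    congr 1
    simp only [mul_inv, Units.val_mul, Units.val_inv_eq_inv_val]
    field_simp
    ring
  have hE : ∑ z : Eˣ, Ψ (Algebra.trace F E (algebraMap F E a * z + algebraMap F E b * (z⁻¹ : Eˣ)))
      = ∑ z : Eˣ, f (Algebra.trace F E (z : E), Units.map (Algebra.norm F) z) := by
    refine Finset.sum_congr rfl fun z _ => ?_
    change _ = Ψ _
    congr 1
    have h1 : Algebra.trace F E ((z⁻¹ : Eˣ) : E)
        = Algebra.trace F E (z : E) * ((Units.map (Algebra.norm F) z)⁻¹ : Fˣ) := by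
      apply (algebraMap F E).injective
      have hz : FiniteField.frobeniusAlgHom F E (z : E) ≠ 0 := by simp
      rw [Units.val_inv_eq_inv_val, Units.val_inv_eq_inv_val, Units.coe_map,
        map_mul, map_inv₀ (algebraMap F E), algebraMap_trace_eq_add_frobenius h2 ((z : E)⁻¹),
        algebraMap_trace_eq_add_frobenius h2 (z : E), algebraMap_norm_eq_mul_frobenius h2,
        map_inv₀ (FiniteField.frobeniusAlgHom F E)]
      field_simp
      ring
    rw [map_add, ← Algebra.smul_def, ← Algebra.smul_def, map_smul, map_smul, h1, smul_eq_mul,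
      smul_eq_mul]
    ring
  have htot : ∑ st, f st = Fintype.card F := by
    rw [Fintype.sum_prod_type_right]
    have hprim : Ψ.IsPrimitive := AddChar.IsPrimitive.of_ne_one hΨ
    have hin (t : Fˣ) : ∑ s : F, f (s, t)
        = if t = Units.mk0 (-b / a) (div_ne_zero (neg_ne_zero.2 hb) ha)
          then (Fintype.card F : ℂ) else 0 := by
      have := AddChar.sum_mulShift (a + b * (t⁻¹ : Fˣ)) hprim
      rw [this, Nat.cast_ite, Nat.cast_zero]
      refine if_congr ?_ rfl rfl
      rw [Units.ext_iff, Units.val_mk0, Units.val_inv_eq_inv_val]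
      constructor
      · intro h; field_simp at h ⊢; linear_combination h
      · intro h; rw [h]; field_simp; ring
    simp_rw [hin]
    simp
  rw [hE, hsq, sum_comp_eq_sum_card_mul, sum_comp_eq_sum_card_mul, eq_sub_iff_add_eq,
    ← Finset.sum_add_distrib, ← htot, Finset.mul_sum]
  refine Finset.sum_congr rfl fun ⟨s, t⟩ _ => ?_
  rw [← add_mul, card_pair_fiber hF, card_trace_norm_fiber h2 hF, add_comm]
  congr 1
  exact_mod_cast card_sqrt_add_card_sqrt h2 hF _

end QuadraticExtension

section WeilBound

/-- The exponential sums over the tower of quadratic extensions of `𝔽_p`, starting from `S`. -/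
noncomputable def towerSum (p : ℕ) (S : ℂ) : ℕ → ℂ
  | 0 => S
  | k + 1 => 2 * (p : ℂ) ^ 2 ^ k - towerSum p S k ^ 2

open Classical in
theorem exists_field_sum_eq_towerSum {p : ℕ} [Fact p.Prime] (hp2 : p ≠ 2)
    {ψ : AddChar (ZMod p) ℂ} (hψ : ψ ≠ 1) {a b : ZMod p} (ha : a ≠ 0) (hb : b ≠ 0) (k : ℕ) :
    ∃ (F : Type) (_ : Field F) (_ : Fintype F) (_ : Algebra (ZMod p) F),
      Fintype.card F = p ^ 2 ^ k ∧
      ∑ x : Fˣ, ψ (Algebra.trace (ZMod p) F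
          (algebraMap (ZMod p) F a * x + algebraMap (ZMod p) F b * (x⁻¹ : Fˣ)))
        = towerSum p (∑ x : (ZMod p)ˣ, ψ (a * x + b * (x⁻¹ : (ZMod p)ˣ))) k := by
  induction k with
  | zero =>
    refine ⟨ZMod p, inferInstance, inferInstance, inferInstance, by simp [ZMod.card], ?_⟩
    rw [towerSum]
    simp only [Algebra.trace_self_apply, Algebra.algebraMap_self, RingHom.id_apply]
    congr!
  | succ k ih =>
    obtain ⟨F, _, _, _, hcard, hsum⟩ := ih
    have : CharP F p := charP_of_injective_algebraMap (algebraMap (ZMod p) F).injective p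
    let E := FiniteField.Extension F p 2
    have : Fintype E := Fintype.ofFinite E
    have h2 : Module.finrank F E = 2 := FiniteField.finrank_extension F p 2
    have hF : ringChar F ≠ 2 := by rwa [ringChar.eq F p]
    have : FiniteDimensional (ZMod p) F := Module.Finite.of_finite
    let Ψ : AddChar F ℂ := ψ.compAddMonoidHom (Algebra.trace (ZMod p) F).toAddMonoidHom
    have hΨ : Ψ ≠ 1 := by
      intro h
      refine hψ (DFunLike.ext _ _ fun x => ?_)
      obtain ⟨y, rfl⟩ := Algebra.trace_surjective (ZMod p) F x
      exact DFunLike.congr_fun h y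
    refine ⟨E, inferInstance, inferInstance, inferInstance, ?_, ?_⟩
    · rw [Module.card_eq_pow_finrank (K := F), h2, hcard, ← pow_mul, pow_succ]
    · have := sum_quadratic_extension (E := E) h2 hF hΨ
        ((map_ne_zero (algebraMap (ZMod p) F)).2 ha) ((map_ne_zero (algebraMap (ZMod p) F)).2 hb)
      rw [towerSum, ← hsum]
      rw [hcard, Nat.cast_pow] at this
      refine Eq.trans (Finset.sum_congr rfl fun z _ => ?_) this
      change _ = ψ (Algebra.trace (ZMod p) F _)
      rw [Algebra.trace_trace, ← IsScalarTower.algebraMap_apply, ← IsScalarTower.algebraMap_apply]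

open Classical in
theorem norm_sum_trace_le {p : ℕ} [Fact p.Prime] {ψ : AddChar (ZMod p) ℂ} (hψ : ψ ≠ 1)
    {a b : ZMod p} (ha : a ≠ 0) {s : ℕ} {F : Type*} [Field F] [Fintype F] [Algebra (ZMod p) F]
    (hcard : Fintype.card F = p ^ (2 * (s + 1))) :
    ‖∑ x : Fˣ, ψ (Algebra.trace (ZMod p) F
          (algebraMap (ZMod p) F a * x + algebraMap (ZMod p) F b * (x⁻¹ : Fˣ)))‖
      ≤ 12 * p * (p : ℝ) ^ (s + 1) := by
  have hp : p.Prime := Fact.out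
  have : CharP F p := charP_of_injective_algebraMap (algebraMap (ZMod p) F).injective p
  have hrank : Module.finrank (ZMod p) F = 2 * (s + 1) := by
    have := Module.card_eq_pow_finrank (K := ZMod p) (V := F)
    rw [hcard, ZMod.card] at this
    exact (Nat.pow_right_injective hp.two_le this).symm
  have hfix (c : ZMod p) : algebraMap (ZMod p) F c ^ p = algebraMap (ZMod p) F c := by
    rw [← map_pow, ZMod.pow_card]
  set g : Fˣ → ZMod p := fun x => Algebra.trace (ZMod p) F
          (algebraMap (ZMod p) F a * x + algebraMap (ZMod p) F b * (x⁻¹ : Fˣ)) with hg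
  set n : ZMod p → ℕ := fun c => (Finset.univ.filter fun x => g x = c).card with hn
  have hle (c : ZMod p) : n c ≤ p ^ (2 * s + 1) + 11 * p ^ (s + 1) := by
    rw [hn]
    dsimp only
    rw [← Finset.card_map ⟨Units.val, Units.val_injective⟩]
    refine card_trace_fiber_le hcard ((map_ne_zero (algebraMap (ZMod p) F)).2 ha) (hfix a)
      (hfix b) (hfix c) _ fun y hy => ?_
    simp only [Finset.mem_map, Finset.mem_filter, Finset.mem_univ, true_and,
      Function.Embedding.coeFn_mk] at hy
    obtain ⟨x, hx, rfl⟩ := hy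
    refine ⟨x.ne_zero, ?_⟩
    rw [← hx, hg]
    dsimp only
    rw [FiniteField.algebraMap_trace_eq_sum_pow, hrank, Nat.card_zmod, Units.val_inv_eq_inv_val]
  have htot : ∑ c, n c = p ^ (2 * (s + 1)) - 1 := by
    rw [← hcard, ← Fintype.card_units, ← Finset.card_univ]
    exact (Finset.card_eq_sum_card_fiberwise fun x _ => Finset.mem_univ _).symm
  have htot' : ∑ c, (n c : ℝ) = (p : ℝ) ^ (2 * (s + 1)) - 1 := by
    rw [← Nat.cast_sum, htot, Nat.cast_sub (Nat.one_le_pow _ _ hp.pos)]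
    push_cast
    rfl
  have hψ0 : ∑ c, ψ c = 0 := AddChar.sum_eq_zero_of_ne_one hψ
  set B : ℕ := p ^ (2 * s + 1) + 11 * p ^ (s + 1) with hB
  have heq : ∑ x, ψ (g x) = -∑ c, (((B : ℝ) - n c : ℝ) : ℂ) * ψ c := by
    rw [sum_comp_eq_sum_card_mul]
    push_cast
    simp_rw [sub_mul]
    rw [Finset.sum_sub_distrib, ← Finset.mul_sum, hψ0, mul_zero, zero_sub, neg_neg]
  rw [heq, norm_neg]
  have h1 : (1 : ℝ) ≤ p * (p : ℝ) ^ (s + 1) := by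
    have : (1 : ℝ) ≤ p := by exact_mod_cast hp.one_le
    nlinarith [one_le_pow₀ this (n := s + 1)]
  calc ‖∑ c, (((B : ℝ) - n c : ℝ) : ℂ) * ψ c‖
      ≤ ∑ c, ‖(((B : ℝ) - n c : ℝ) : ℂ) * ψ c‖ := norm_sum_le _ _
    _ = ∑ c, ((B : ℝ) - n c) := by
        refine Finset.sum_congr rfl fun c _ => ?_
        have : (n c : ℝ) ≤ B := by exact_mod_cast hle c
        rw [norm_mul, AddChar.norm_apply, mul_one, Complex.norm_real, Real.norm_eq_abs,
          abs_of_nonneg (by linarith)]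
    _ = p * B - ((p : ℝ) ^ (2 * (s + 1)) - 1) := by
        rw [Finset.sum_sub_distrib, htot']
        simp [ZMod.card]
    _ = 11 * p * (p : ℝ) ^ (s + 1) + 1 := by
        rw [hB]
        push_cast
        ring
    _ ≤ 12 * p * (p : ℝ) ^ (s + 1) := by linarith

theorem le_two_of_iterate_le {y : ℕ → ℝ} {C : ℝ} (hrec : ∀ k, y k ^ 2 - 2 ≤ y (k + 1))
    (hC : ∀ k, y (k + 1) ≤ C) : y 0 ≤ 2 := by
  by_contra! h
  have hgrow (k : ℕ) : 2 + 4 ^ k * (y 0 - 2) ≤ y k := by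
    induction k with
    | zero => simp
    | succ k ih =>
      have := hrec k
      have h4 : 0 < 4 ^ k * (y 0 - 2) := by
        have : 0 < y 0 - 2 := by linarith
        positivity
      rw [pow_succ]
      nlinarith
  obtain ⟨k, hk⟩ := pow_unbounded_of_one_lt (C / (y 0 - 2)) (by norm_num : (1 : ℝ) < 4)
  rw [div_lt_iff₀ (by linarith)] at hk
  have h1 := hgrow (k + 1)
  have h2 := hC k
  have h3 : 0 < 4 ^ k * (y 0 - 2) := by
    have : 0 < y 0 - 2 := by linarith
    positivity
  rw [pow_succ] at h1
  linarith

theorem norm_kloosterman_le {p : ℕ} [Fact p.Prime] (hp2 : p ≠ 2) {ψ : AddChar (ZMod p) ℂ}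
    (hψ : ψ ≠ 1) {a b : ZMod p} (ha : a ≠ 0) (hb : b ≠ 0) :
    ‖∑ x : (ZMod p)ˣ, ψ (a * x + b * (x⁻¹ : (ZMod p)ˣ))‖ ≤ 2 * √p := by
  have hp : 0 < (p : ℝ) := by exact_mod_cast (Fact.out : p.Prime).pos
  set S := ∑ x : (ZMod p)ˣ, ψ (a * x + b * (x⁻¹ : (ZMod p)ˣ))
  have hr : 0 < √(p : ℝ) := Real.sqrt_pos.2 hp
  have hr2 : √(p : ℝ) ^ 2 = p := Real.sq_sqrt hp.le
  have key : ‖towerSum p S 0‖ / √p ^ 2 ^ 0 ≤ 2 := by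
    refine le_two_of_iterate_le (y := fun k => ‖towerSum p S k‖ / √p ^ 2 ^ k) (C := 12 * p) ?_ ?_
    · intro k
      rw [pow_succ 2 k, pow_mul, div_pow, le_div_iff₀ (by positivity), sub_mul,
        div_mul_cancel₀ _ (by positivity), towerSum, ← pow_mul, mul_comm (2 ^ k) 2, pow_mul, hr2,
        ← norm_pow]
      have := norm_sub_norm_le (towerSum p S k ^ 2) (2 * (p : ℂ) ^ 2 ^ k)
      rw [norm_sub_rev] at this
      simpa using this
    · intro k
      obtain ⟨F, _, _, _, hcard, hsum⟩ := exists_field_sum_eq_towerSum hp2 hψ ha hb (k + 1)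
      obtain ⟨s, hs⟩ : ∃ s, 2 ^ (k + 1) = 2 * (s + 1) :=
        ⟨2 ^ k - 1, by have := Nat.one_le_two_pow (n := k); omega⟩
      rw [← hsum, div_le_iff₀ (by positivity), hs, pow_mul, hr2]
      exact norm_sum_trace_le hψ ha (by rw [hcard, hs])
  rw [pow_zero, pow_one, div_le_iff₀ hr] at key
  exact key

end WeilBound

section HyperbolaBox

variable {p : ℕ} [Fact p.Prime]

theorem sum_units_mul_eq_neg_one {ψ : AddChar (ZMod p) ℂ} (hψ : ψ ≠ 1) {b : ZMod p} (hb : b ≠ 0) :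
    ∑ x : (ZMod p)ˣ, ψ (b * x) = -1 := by
  have h := AddChar.sum_mulShift b (AddChar.IsPrimitive.of_ne_one hψ)
  rw [if_neg hb, Nat.cast_zero, ← Finset.add_sum_erase _ _ (Finset.mem_univ (0 : ZMod p)),
    zero_mul, AddChar.map_zero_eq_one] at h
  rw [eq_neg_iff_add_eq_zero, add_comm, ← h]
  congr 1
  refine Finset.sum_bij (fun x _ => (x : ZMod p)) (by simp) (by simp [Units.ext_iff]) ?_ ?_
  · intro y hy
    exact ⟨Units.mk0 y (by simpa using hy), Finset.mem_univ _, rfl⟩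
  · intro x _
    rw [mul_comm]

theorem norm_sum_units_le (hp2 : p ≠ 2) {ψ : AddChar (ZMod p) ℂ} (hψ : ψ ≠ 1) {a b : ZMod p}
    (hab : (a, b) ≠ 0) :
    ‖∑ x : (ZMod p)ˣ, ψ (a * x + b * (x⁻¹ : (ZMod p)ˣ))‖ ≤ 2 * √p := by
  have h1 : (1 : ℝ) ≤ 2 * √p := by
    have : 1 ≤ √(p : ℝ) := by
      rw [Real.one_le_sqrt]
      exact_mod_cast (Fact.out : p.Prime).one_le
    linarith
  by_cases ha : a = 0
  · subst ha
    have hb : b ≠ 0 := by rintro rfl; exact hab rfl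
    have : ∑ x : (ZMod p)ˣ, ψ (0 * x + b * (x⁻¹ : (ZMod p)ˣ)) = -1 := by
      rw [← sum_units_mul_eq_neg_one hψ hb]
      exact Fintype.sum_equiv (Equiv.inv _) _ _ fun x => by rw [zero_mul, zero_add]; rfl
    rw [this]
    simpa using h1
  by_cases hb : b = 0
  · subst hb
    simp_rw [zero_mul, add_zero]
    rw [sum_units_mul_eq_neg_one hψ ha]
    simpa using h1
  exact norm_kloosterman_le hp2 hψ ha hb

theorem sum_norm_sq_sum_eq {ψ : AddChar (ZMod p) ℂ} (hψ : ψ ≠ 1) (U : Finset (ZMod p)) :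
    ∑ a, ‖∑ u ∈ U, ψ (a * u)‖ ^ 2 = p * U.card := by
  have h (a : ZMod p) : ((‖∑ u ∈ U, ψ (a * u)‖ ^ 2 : ℝ) : ℂ)
      = ∑ u ∈ U, ∑ v ∈ U, ψ (a * (u - v)) := by
    rw [Complex.ofReal_pow, ← Complex.mul_conj', map_sum, Finset.sum_mul_sum]
    refine Finset.sum_congr rfl fun u _ => Finset.sum_congr rfl fun v _ => ?_
    rw [← AddChar.map_neg_eq_conj, ← AddChar.map_add_eq_mul]
    ring_nf
  have hC : ((∑ a, ‖∑ u ∈ U, ψ (a * u)‖ ^ 2 : ℝ) : ℂ) = p * U.card := by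
    rw [Complex.ofReal_sum]
    simp_rw [h]
    rw [Finset.sum_comm]
    have hu (u : ZMod p) (hu : u ∈ U) : ∑ a, ∑ v ∈ U, ψ (a * (u - v)) = p := by
      rw [Finset.sum_comm, Finset.sum_eq_single u]
      · simp [ZMod.card]
      · intro v _ hv
        rw [AddChar.sum_mulShift _ (AddChar.IsPrimitive.of_ne_one hψ),
          if_neg (sub_ne_zero.2 hv.symm), Nat.cast_zero]
      · exact fun h => absurd hu h
    rw [Finset.sum_congr rfl hu, Finset.sum_const, nsmul_eq_mul, mul_comm]
  exact_mod_cast hC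

theorem exists_mul_eq_one_of_card (hp2 : p ≠ 2) {U : Finset (ZMod p)}
    (hU : 2 * √p * p ^ 2 < (U.card : ℝ) ^ 2 * (p - 1)) (x₀ y₀ : ZMod p) :
    ∃ u₁ ∈ U, ∃ u₂ ∈ U, ∃ v₁ ∈ U, ∃ v₂ ∈ U, (x₀ + u₁ + u₂) * (y₀ + v₁ + v₂) = 1 := by
  by_contra! hne
  have hp : p.Prime := Fact.out
  let ψ : AddChar (ZMod p) ℂ := ZMod.stdAddChar
  have hprim : ψ.IsPrimitive := ZMod.isPrimitive_stdAddChar p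
  have hψ : ψ ≠ 1 := by
    have := hprim one_ne_zero
    rwa [AddChar.mulShift_one] at this
  let R : ZMod p → ℂ := fun a => ∑ u ∈ U, ψ (a * u)
  let K : ZMod p → ZMod p → ℂ := fun a b => ∑ x : (ZMod p)ˣ, ψ (a * x + b * (x⁻¹ : (ZMod p)ˣ))
  let T : ZMod p × ZMod p → ℂ := fun ab =>
    ψ (ab.1 * x₀ + ab.2 * y₀) * R ab.1 ^ 2 * R ab.2 ^ 2 * K (-ab.1) (-ab.2)
  let W := U ×ˢ U ×ˢ U ×ˢ U ×ˢ (Finset.univ : Finset (ZMod p)ˣ)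
  have hT (a b : ZMod p) : T (a, b) = ∑ w ∈ W,
      ψ (a * (x₀ + w.1 + w.2.1 - w.2.2.2.2)) *
        ψ (b * (y₀ + w.2.2.1 + w.2.2.2.1 - (w.2.2.2.2⁻¹ : (ZMod p)ˣ))) := by
    have hsplit (w : ZMod p × ZMod p × ZMod p × ZMod p × (ZMod p)ˣ) :
        ψ (a * (x₀ + w.1 + w.2.1 - w.2.2.2.2)) *
          ψ (b * (y₀ + w.2.2.1 + w.2.2.2.1 - (w.2.2.2.2⁻¹ : (ZMod p)ˣ)))
        = ψ (a * w.1) * (ψ (a * w.2.1) * (ψ (b * w.2.2.1) * (ψ (b * w.2.2.2.1) *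
          (ψ (a * x₀ + b * y₀) * ψ (-a * w.2.2.2.2 + -b * (w.2.2.2.2⁻¹ : (ZMod p)ˣ)))))) := by
      simp only [← AddChar.map_add_eq_mul]
      congr 1
      ring
    rw [Finset.sum_congr rfl fun w _ => hsplit w]
    simp only [W, Finset.sum_product, ← Finset.mul_sum, ← Finset.sum_mul]
    simp only [T, R, K]
    ring
  have hsum : ∑ ab, T ab = 0 := by
    rw [Fintype.sum_prod_type]
    simp_rw [hT]
    rw [(Finset.sum_congr rfl fun a _ => Finset.sum_comm).trans Finset.sum_comm]
    refine Finset.sum_eq_zero fun ⟨u₁, u₂, v₁, v₂, x⟩ hw => ?_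
    simp only [W, Finset.mem_product, Finset.mem_univ, and_true] at hw
    rw [← Finset.sum_mul_sum, AddChar.sum_mulShift _ hprim, AddChar.sum_mulShift _ hprim]
    by_cases hx : x₀ + u₁ + u₂ - x = 0
    · have hy : y₀ + v₁ + v₂ - (x⁻¹ : (ZMod p)ˣ) ≠ 0 := fun hy => by
        refine hne u₁ hw.1 u₂ hw.2.1 v₁ hw.2.2.1 v₂ hw.2.2.2 ?_
        rw [sub_eq_zero.1 hx, sub_eq_zero.1 hy, Units.mul_inv]
      rw [if_neg hy, Nat.cast_zero, mul_zero]
    · rw [if_neg hx, Nat.cast_zero, zero_mul]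
  have hT0 : T 0 = (U.card : ℂ) ^ 4 * (p - 1) := by
    simp only [T, R, K, Prod.fst_zero, Prod.snd_zero, zero_mul, neg_zero, add_zero,
      AddChar.map_zero_eq_one, Finset.sum_const, nsmul_eq_mul, mul_one, one_mul,
      Finset.card_univ, ZMod.card_units, Nat.cast_sub hp.one_le, Nat.cast_one]
    ring
  have hTle (ab : ZMod p × ZMod p) (hab : ab ≠ 0) :
      ‖T ab‖ ≤ 2 * √p * (‖R ab.1‖ ^ 2 * ‖R ab.2‖ ^ 2) := by
    simp only [T]
    rw [norm_mul, norm_mul, norm_mul, AddChar.norm_apply, one_mul, norm_pow, norm_pow, mul_comm]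
    have : (-ab.1, -ab.2) ≠ 0 := fun h => hab (neg_eq_zero.1 h)
    exact mul_le_mul_of_nonneg_right (norm_sum_units_le hp2 hψ this) (by positivity)
  have hmain : (U.card : ℝ) ^ 4 * (p - 1) ≤ 2 * √p * (p * U.card) ^ 2 := by
    have h1 : (1 : ℝ) ≤ p := by exact_mod_cast hp.one_le
    rw [← Finset.add_sum_erase _ _ (Finset.mem_univ 0), ← eq_neg_iff_add_eq_zero, hT0] at hsum
    calc (U.card : ℝ) ^ 4 * (p - 1) = ‖(U.card : ℂ) ^ 4 * (p - 1)‖ := by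
          have : ((U.card : ℂ) ^ 4 * (p - 1)) = (((U.card : ℝ) ^ 4 * (p - 1) : ℝ) : ℂ) := by
            push_cast; rfl
          rw [this, Complex.norm_real, Real.norm_eq_abs, abs_of_nonneg]
          have : (0 : ℝ) ≤ p - 1 := by linarith
          positivity
      _ ≤ ∑ ab ∈ Finset.univ.erase 0, ‖T ab‖ := by
          rw [hsum, norm_neg]
          exact norm_sum_le _ _
      _ ≤ ∑ ab ∈ Finset.univ.erase (0 : ZMod p × ZMod p), 2 * √p * (‖R ab.1‖ ^ 2 * ‖R ab.2‖ ^ 2) := by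
          refine Finset.sum_le_sum fun ab hab => ?_
          exact hTle ab (Finset.mem_erase.1 hab).1
      _ ≤ ∑ ab : ZMod p × ZMod p, 2 * √p * (‖R ab.1‖ ^ 2 * ‖R ab.2‖ ^ 2) :=
          Finset.sum_le_sum_of_subset_of_nonneg (Finset.erase_subset _ _) fun _ _ _ => by
            positivity
      _ = 2 * √p * (p * U.card) ^ 2 := by
          rw [← Finset.mul_sum, Fintype.sum_prod_type]
          dsimp only
          rw [← Finset.sum_mul_sum, sum_norm_sq_sum_eq hψ, sq]
  have hU0 : 0 < (U.card : ℝ) := by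
    rcases (Nat.cast_nonneg U.card : (0 : ℝ) ≤ U.card).eq_or_lt with h | h
    · rw [← h] at hU
      have : 0 ≤ 2 * √(p : ℝ) * p ^ 2 := by positivity
      linarith
    · exact h
  nlinarith [mul_lt_mul_of_pos_left hU (pow_pos hU0 2)]

end HyperbolaBox

section SmallestElements

theorem exists_modInv_mem_box {p : ℕ} [Fact p.Prime] (hp2 : p ≠ 2) {N : ℕ}
    (hN : 2 * √p * p ^ 2 < (N : ℝ) ^ 2 * (p - 1)) {x₀ y₀ : ℕ} (hx : 0 < x₀) (hx' : x₀ + 2 * N ≤ p)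
    (hy' : y₀ + 2 * N ≤ p) :
    ∃ β, x₀ ≤ β ∧ β < x₀ + 2 * N ∧ y₀ ≤ modInv p β ∧ modInv p β < y₀ + 2 * N := by
  have hp : p.Prime := Fact.out
  let U : Finset (ZMod p) := (Finset.range N).image fun u : ℕ => (u : ZMod p)
  have hcard : U.card = N := by
    rw [Finset.card_image_of_injOn, Finset.card_range]
    intro u hu v hv h
    have hu' : u < N := by simpa using hu
    have hv' : v < N := by simpa using hv
    have h' := congrArg ZMod.val (show (u : ZMod p) = v from h)
    rwa [ZMod.val_natCast_of_lt (by omega), ZMod.val_natCast_of_lt (by omega)] at h'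
  obtain ⟨_, hu₁, _, hu₂, _, hv₁, _, hv₂, h⟩ :=
    exists_mul_eq_one_of_card hp2 (U := U) (by rwa [hcard]) (x₀ : ZMod p) (y₀ : ZMod p)
  simp only [U, Finset.mem_image, Finset.mem_range] at hu₁ hu₂ hv₁ hv₂
  obtain ⟨u₁, hu₁, rfl⟩ := hu₁
  obtain ⟨u₂, hu₂, rfl⟩ := hu₂
  obtain ⟨v₁, hv₁, rfl⟩ := hv₁
  obtain ⟨v₂, hv₂, rfl⟩ := hv₂
  have hinv : modInv p (x₀ + u₁ + u₂) = y₀ + v₁ + v₂ := by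
    rw [modInv, ← ZMod.val_natCast_of_lt (show y₀ + v₁ + v₂ < p by omega)]
    congr 1
    push_cast
    exact inv_eq_of_mul_eq_one_right h
  exact ⟨x₀ + u₁ + u₂, by omega, by omega, by omega, by omega⟩

theorem exists_box_side {p : ℕ} (hp : 3 ≤ p)
    (hlog : 18 * Real.log p < (p : ℝ) ^ ((1 : ℝ) / 4)) :
    ∃ N : ℕ, 4 ≤ N ∧ 8 * N + 3 ≤ p / 3 ∧ 2 * √p * p ^ 2 < (N : ℝ) ^ 2 * (p - 1) ∧
      4 * (N : ℝ) ≤ 3 * (p : ℝ) ^ ((3 : ℝ) / 4) * Real.log p := by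
  have hp0 : (0 : ℝ) ≤ p := Nat.cast_nonneg p
  set q : ℝ := (p : ℝ) ^ ((1 : ℝ) / 4) with hq
  have hq4 : (p : ℝ) = q ^ 4 := by
    rw [hq, ← Real.rpow_natCast, ← Real.rpow_mul hp0]; norm_num
  have hq3 : (p : ℝ) ^ ((3 : ℝ) / 4) = q ^ 3 := by
    rw [hq, ← Real.rpow_natCast, ← Real.rpow_mul hp0]; norm_num
  have hq2 : √(p : ℝ) = q ^ 2 := by
    rw [hq, Real.sqrt_eq_rpow, ← Real.rpow_natCast, ← Real.rpow_mul hp0]; norm_num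
  have hp3 : (3 : ℝ) ≤ p := by exact_mod_cast hp
  have he := Real.exp_one_lt_d9
  have hlog1 : 1 ≤ Real.log p := by
    rw [Real.le_log_iff_exp_le (by linarith)]
    linarith
  have hq18 : 18 ≤ q := by linarith
  have hlog3 : 3 ≤ Real.log p := by
    rw [Real.le_log_iff_exp_le (by linarith), hq4, show (3 : ℝ) = ((3 : ℕ) : ℝ) * 1 by norm_num,
      Real.exp_nat_mul]
    calc Real.exp 1 ^ 3 ≤ 3 ^ 3 := by gcongr; linarith
      _ ≤ 18 ^ 4 := by norm_num
      _ ≤ q ^ 4 := by gcongr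
  have hq54 : 54 ≤ q := by linarith
  have hcube : (54 : ℝ) ^ 3 ≤ q ^ 3 := by gcongr
  have hfour : 54 * q ^ 3 ≤ q ^ 4 := by
    rw [pow_succ q 3, mul_comm]
    gcongr
  refine ⟨⌈2 * q ^ 3⌉₊, ?_, ?_, ?_, ?_⟩
  all_goals
    have hl : 2 * q ^ 3 ≤ (⌈2 * q ^ 3⌉₊ : ℝ) := Nat.le_ceil _
    have hu : (⌈2 * q ^ 3⌉₊ : ℝ) < 2 * q ^ 3 + 1 := Nat.ceil_lt_add_one (by positivity)
    generalize ⌈2 * q ^ 3⌉₊ = N at hl hu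
  · have : (4 : ℝ) ≤ N := by linarith
    exact_mod_cast this
  · have : (3 * (8 * N + 3) : ℝ) ≤ p := by rw [hq4]; linarith
    have : 3 * (8 * N + 3) ≤ p := by exact_mod_cast this
    omega
  · have h1 : (2 * q ^ 3) ^ 2 ≤ (N : ℝ) ^ 2 := by gcongr
    have h2 : 2 < q ^ 4 := by linarith
    rw [hq2, hq4]
    calc 2 * q ^ 2 * (q ^ 4) ^ 2 < (2 * q ^ 3) ^ 2 * (q ^ 4 - 1) := by
          have : 0 < 2 * q ^ 6 * (q ^ 4 - 2) := mul_pos (by positivity) (by linarith)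
          nlinarith
      _ ≤ _ := mul_le_mul_of_nonneg_right h1 (by linarith)
  · rw [hq3]
    have : 3 * q ^ 3 * 3 ≤ 3 * q ^ 3 * Real.log p := by gcongr
    linarith

theorem le_of_rpow_le_log {p β : ℕ} (hβ : 2 * β ≤ p)
    (hlog : (p : ℝ) ^ ((1 : ℝ) / 4) ≤ 18 * Real.log p) :
    (β : ℝ) ≤ p / 3 + 3 * (p : ℝ) ^ ((3 : ℝ) / 4) * Real.log p := by
  have hp0 : (0 : ℝ) ≤ p := Nat.cast_nonneg p
  have hβ' : 2 * (β : ℝ) ≤ p := by exact_mod_cast hβ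
  have hmul : (p : ℝ) ^ ((3 : ℝ) / 4) * (p : ℝ) ^ ((1 : ℝ) / 4) = p := by
    rw [← Real.rpow_add_of_nonneg hp0 (by norm_num) (by norm_num)]
    norm_num
  have := mul_le_mul_of_nonneg_left hlog (Real.rpow_nonneg hp0 ((3 : ℝ) / 4))
  rw [hmul] at this
  linarith

theorem min'_le_of_forall_box {p : ℕ} (hp : p.Prime) {B : Finset ℕ}
    (hB : ∀ β ∈ B, 0 < β ∧ 2 * β + 3 ≤ p)
    (hbox : Fact p.Prime → p ≠ 2 → ∀ N, 4 ≤ N → 8 * N + 3 ≤ p / 3 →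
      2 * √p * p ^ 2 < (N : ℝ) ^ 2 * (p - 1) → ∃ β ∈ B, β ≤ p / 3 + 4 * N) (hne : B.Nonempty) :
    ((B.min' hne : ℕ) : ℝ) ≤ p / 3 + 3 * (p : ℝ) ^ ((3 : ℝ) / 4) * Real.log p := by
  have hmin := hB _ (B.min'_mem hne)
  rcases le_or_gt ((p : ℝ) ^ ((1 : ℝ) / 4)) (18 * Real.log p) with h | h
  · exact le_of_rpow_le_log (by omega) h
  · obtain ⟨N, h4, h8, hN, hle⟩ := exists_box_side (by omega) h
    obtain ⟨β, hβ, hβN⟩ := hbox ⟨hp⟩ (by omega) N h4 h8 hN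
    have h1 : ((B.min' hne : ℕ) : ℝ) ≤ ((p / 3 : ℕ) : ℝ) + 4 * N := by
      exact_mod_cast (B.min'_le β hβ).trans hβN
    have h2 : ((p / 3 : ℕ) : ℝ) ≤ p / 3 := Nat.cast_div_le
    linarith

end SmallestElements

theorem stmt_16 (p : ℕ) (hp : p.Prime) :
    (∀ β ∈ Bminus p, (p : ℝ) / 3 ≤ (β : ℝ)) ∧
    (∀ β ∈ Bplus p, (p : ℝ) / 3 ≤ (β : ℝ)) ∧
    (∀ hne : (Bminus p).Nonempty,
      (((Bminus p).min' hne : ℕ) : ℝ) ≤ (p : ℝ) / 3 + 4.25 * (p : ℝ) ^ ((3 : ℝ) / 4) * Real.log p) ∧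
    (∀ hne : (Bplus p).Nonempty,
      (((Bplus p).min' hne : ℕ) : ℝ) ≤ (p : ℝ) / 3 + 3 * (p : ℝ) ^ ((3 : ℝ) / 4) * Real.log p) := by
  have hthird {β : ℕ} (h : p ≤ 3 * β) : (p : ℝ) / 3 ≤ β := by
    have : (p : ℝ) ≤ 3 * β := by exact_mod_cast h
    linarith
  refine ⟨fun β hβ => hthird ?_, fun β hβ => hthird ?_, fun hne => ?_, fun hne => ?_⟩
  · simp only [Bminus, Finset.mem_filter, Finset.mem_Icc] at hβ
    omega
  · simp only [Bplus, Finset.mem_filter, Finset.mem_Icc] at hβ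
    omega
  · have hlog : 0 ≤ (p : ℝ) ^ ((3 : ℝ) / 4) * Real.log p :=
      mul_nonneg (Real.rpow_nonneg (Nat.cast_nonneg p) _) (Real.log_natCast_nonneg p)
    have := min'_le_of_forall_box hp (B := Bminus p) ?_ ?_ hne
    · linarith
    · intro β hβ
      simp only [Bminus, Finset.mem_filter, Finset.mem_Icc] at hβ
      omega
    · intro _ hp2 N h4 h8 hN
      obtain ⟨β, h1, h2, h3, h5⟩ := exists_modInv_mem_box hp2 hN
        (x₀ := p / 3 + 2 * N) (y₀ := p / 3) (by omega) (by omega) (by omega)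
      refine ⟨β, ?_, by omega⟩
      simp only [Bminus, Finset.mem_filter, Finset.mem_Icc]
      omega
  · refine min'_le_of_forall_box hp (B := Bplus p) ?_ ?_ hne
    · intro β hβ
      simp only [Bplus, Finset.mem_filter, Finset.mem_Icc] at hβ
      omega
    · intro _ hp2 N h4 h8 hN
      obtain ⟨β, h1, h2, h3, h5⟩ := exists_modInv_mem_box hp2 hN
        (x₀ := p / 3 + N) (y₀ := p - (p / 3 + N)) (by omega) (by omega) (by omega)
      refine ⟨β, ?_, by omega⟩
      simp only [Bplus, Finset.mem_filter, Finset.mem_Icc]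
      omega
end

section
/- Let p ≥ 2 be a prime. Every element of 𝓑₋(p) and every element of 𝓑₊(p) is at most p/2. Moreover, if 𝓑₊(p) is non-empty then max 𝓑₊(p) ≥ p/2 − 3 · √p · (log p)², and if 𝓑₋(p) is non-empty then max 𝓑₋(p) ≥ p/2 − 6 · √p · (log p)², where log denotes the natural logarithm. -/
lemma modInv_eq {p b r : ℕ} (hp : p.Prime) (hr : r < p) (h : (p : ℤ) ∣ b * r - 1) :
    modInv p b = r := by
  have : Fact p.Prime := ⟨hp⟩
  have h1 : (b : ZMod p) * r = 1 := by
    have := (ZMod.intCast_zmod_eq_zero_iff_dvd _ p).2 h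
    push_cast at this
    exact sub_eq_zero.1 this
  unfold modInv
  rw [inv_eq_of_mul_eq_one_right h1, ZMod.val_natCast, Nat.mod_eq_of_lt hr]

lemma mem_Bminus_of_dvd {p k b : ℕ} {m : ℤ} (hp : p.Prime) (hpk : p = k + 2 * b) (hk : 3 ≤ k)
    (hodd : Odd p) (hd : (k : ℤ) ∣ m * p - 2)
    (h1 : (k : ℤ) ^ 2 + 8 ≤ p * (4 * m - k)) (h2 : (k : ℤ) ^ 2 ≤ p * (k - 2 * m)) :
    b ∈ Bminus p := by
  obtain ⟨r, hr⟩ := hd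
  have hk' : (3 : ℤ) ≤ k := by exact_mod_cast hk
  have hkp : (p : ℤ) = k + 2 * b := by exact_mod_cast hpk
  have r1 : (p : ℤ) + k ≤ 4 * r + 2 := by
    by_contra! hlt
    nlinarith
  have r2 : 2 * r < (p : ℤ) - k := by
    by_contra! hlt
    nlinarith
  have r0 : 0 ≤ r := by linarith
  lift r to ℕ using r0
  have hinv : modInv p b = r := by
    refine modInv_eq hp (by omega) ?_
    have h3 : (p : ℤ) ∣ 2 * (b * r - 1) := ⟨r - m, by rw [hkp] at hr ⊢; linear_combination hr⟩
    refine IsCoprime.dvd_of_dvd_mul_left ?_ h3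
    have : Nat.Coprime p 2 := hodd.coprime_two_right
    exact_mod_cast Nat.isCoprime_iff_coprime.2 this
  simp only [Bminus, Finset.mem_filter, Finset.mem_Icc, hinv]
  omega

lemma mem_Bplus_of_dvd {p k b : ℕ} {m : ℤ} (hp : p.Prime) (hpk : p = k + 2 * b) (hk : 3 ≤ k)
    (hodd : Odd p) (hd : (k : ℤ) ∣ m * p + 2)
    (h1 : (k : ℤ) ^ 2 ≤ p * m) (h2 : (k : ℤ) ^ 2 + 4 ≤ p * (k - 2 * m)) :
    b ∈ Bplus p := by
  obtain ⟨r, hr⟩ := hd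
  have hk' : (3 : ℤ) ≤ k := by exact_mod_cast hk
  have hkp : (p : ℤ) = k + 2 * b := by exact_mod_cast hpk
  have r1 : (k : ℤ) ≤ r := by
    by_contra! hlt
    nlinarith
  have r2 : 2 * r ≤ (p : ℤ) - k := by
    by_contra! hlt
    nlinarith
  have r0 : 0 ≤ r := by linarith
  lift r to ℕ using r0
  have hinv : modInv p b = p - r := by
    refine modInv_eq hp (by omega) ?_
    have h3 : (p : ℤ) ∣ 2 * (b * (p - r : ℕ) - 1) :=
      ⟨2 * b - r + m, by
        rw [Nat.cast_sub (by omega)]; rw [hkp] at hr ⊢; linear_combination -hr⟩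
    refine IsCoprime.dvd_of_dvd_mul_left ?_ h3
    have : Nat.Coprime p 2 := hodd.coprime_two_right
    exact_mod_cast Nat.isCoprime_iff_coprime.2 this
  simp only [Bplus, Finset.mem_filter, Finset.mem_Icc, hinv]
  omega

/-- A residue `ρ` is ruled out by the modulus `k` when `u ≡ 2 / ρ (mod k)` satisfies `cond k u`. The
exponent is `-1` modulo the order of every unit modulo the moduli in use. -/
def sieveHit (cond : ℕ → ℕ → Bool) (k ρ : ℕ) : Bool :=
  cond k (2 * (ρ % k) ^ 239 % k) && ((2 * (ρ % k) ^ 239 % k) * ρ % k == 2)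

/-- Lifts of the residues `L` modulo `M` to units modulo `M * q` which no modulus in `ks` rules
out. -/
def sieveLift (cond : ℕ → ℕ → Bool) (M q : ℕ) (ks L : List ℕ) : List ℕ :=
  (L.flatMap fun ρ => (List.range q).map fun i => ρ + M * i).filter fun ρ =>
    decide (ρ % q ≠ 0) && !(ks.any fun k => sieveHit cond k ρ)

lemma mod_mem_sieveLift {cond : ℕ → ℕ → Bool} {M q p : ℕ} {ks L : List ℕ}
    (hq : 0 < q) (hL : p % M ∈ L) (hpq : p % q ≠ 0) (hks : ∀ k ∈ ks, k ∣ M * q)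
    (hk : ∀ k ∈ ks, ∀ u, cond k u = true → u * p % k ≠ 2) :
    p % (M * q) ∈ sieveLift cond M q ks L := by
  unfold sieveLift
  rw [List.mem_filter]
  constructor
  · rw [List.mem_flatMap]
    refine ⟨_, hL, ?_⟩
    rw [List.mem_map]
    exact ⟨p / M % q, List.mem_range.2 (Nat.mod_lt _ hq), (Nat.mod_mul).symm⟩
  · rw [Bool.and_eq_true]
    constructor
    · rw [Nat.mod_mul_left_mod]
      simpa using hpq
    · rw [Bool.not_eq_true', List.any_eq_false]
      intro k hkm h
      unfold sieveHit at h
      rw [Bool.and_eq_true, beq_iff_eq] at h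
      generalize 2 * (p % (M * q) % k) ^ 239 % k = u at h
      refine hk k hkm u h.1 ?_
      rw [← h.2, ← Nat.mul_mod_mod u (p % (M * q)) k, Nat.mod_mod_of_dvd _ (hks k hkm),
        Nat.mul_mod_mod]

lemma Nat.Prime.mod_mul_mem_sieveLift {p : ℕ} (hp : p.Prime) (h17 : 17 < p) {cond : ℕ → ℕ → Bool}
    {K : ℕ} (h : ∀ k u, 3 ≤ k → k ≤ K → Odd k → cond k u = true → u * p % k ≠ 2)
    (M q : ℕ) (ks L : List ℕ) (h1 : 1 < q) (h2 : q ≤ 17)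
    (hks : ∀ k ∈ ks, k ∣ M * q ∧ 3 ≤ k ∧ k ≤ K ∧ Odd k) (hL : p % M ∈ L) :
    p % (M * q) ∈ sieveLift cond M q ks L := by
  have hq : p % q ≠ 0 := fun h0 => by
    rcases (Nat.dvd_prime hp).1 (Nat.dvd_of_mod_eq_zero h0) with h | h <;> omega
  refine mod_mem_sieveLift (by omega) hL hq (fun k hk => (hks k hk).1) fun k hk u hu => ?_
  obtain ⟨-, h3, h4, h5⟩ := hks k hk
  exact h k u h3 h4 h5 hu

/-- A prime for which `2 / p (mod k)` never lies between `k / 4` and `k / 2`, for `k` odd and small,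
is congruent to `-2`, `4` or `-8` modulo `15015`. -/
lemma mod_eq_of_forall_not_mem_quarter {p : ℕ} (hp : p.Prime) (h17 : 17 < p)
    (h : ∀ k u, 3 ≤ k → k ≤ 2047 → Odd k → k < 4 * u → 2 * u < k → u * p % k ≠ 2) :
    p % 15015 = 15013 ∨ p % 15015 = 4 ∨ p % 15015 = 15007 := by
  have key := hp.mod_mul_mem_sieveLift h17 (cond := fun k u => decide (k < 4 * u ∧ 2 * u < k))
    fun k u h3 h4 h5 hu => h k u h3 h4 h5 (of_decide_eq_true hu).1 (of_decide_eq_true hu).2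
  have s0 : p % 1 ∈ [0] := by simp [Nat.mod_one]
  have s1 := key 1 3 [3] _ (by norm_num) (by norm_num) (by decide) s0
  have s2 := key 3 5 [5] _ (by norm_num) (by norm_num) (by decide) s1
  have s3 := key 15 7 [7, 21, 35, 105] _ (by norm_num) (by norm_num) (by decide) s2
  have s4 := key 105 3 [45, 63, 315] _ (by norm_num) (by norm_num) (by decide) s3
  have s5 := key 315 11 [11, 55, 77, 99, 165, 231, 385, 495, 1155]
    _ (by norm_num) (by norm_num) (by decide) s4
  have s6 := key 3465 13 [13, 39, 91, 117, 195, 429, 455, 585, 715, 1001, 1287]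
    _ (by norm_num) (by norm_num) (by decide) s5
  have s7 := key 45045 5 [25, 75, 275, 325, 975, 1925]
    _ (by norm_num) (by norm_num) (by decide) s6
  have s8 := key 225225 17 [17, 51, 255, 425, 1105, 1309, 1785]
    _ (by norm_num) (by norm_num) (by decide) s7
  have hM : p % 15015 = p % (225225 * 17) % 15015 := (Nat.mod_mod_of_dvd p (by norm_num)).symm
  rw [hM]
  revert s8
  generalize p % (225225 * 17) = ρ
  revert ρ
  decide +kernel

/-- A prime for which `2 / p (mod k)` never lies between `k / 2` and `k`, for `k` odd and small,
is congruent to `2` or `-4` modulo `15015`. -/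
lemma mod_eq_of_forall_not_mem_half {p : ℕ} (hp : p.Prime) (h17 : 17 < p)
    (h : ∀ k u, 3 ≤ k → k ≤ 1000 → Odd k → k < 2 * u → u < k → u * p % k ≠ 2) :
    p % 15015 = 2 ∨ p % 15015 = 15011 := by
  have key := hp.mod_mul_mem_sieveLift h17 (cond := fun k u => decide (k < 2 * u ∧ u < k))
    fun k u h3 h4 h5 hu => h k u h3 h4 h5 (of_decide_eq_true hu).1 (of_decide_eq_true hu).2
  have s0 : p % 1 ∈ [0] := by simp [Nat.mod_one]
  have s1 := key 1 3 [3] _ (by norm_num) (by norm_num) (by decide) s0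
  have s2 := key 3 5 [5] _ (by norm_num) (by norm_num) (by decide) s1
  have s3 := key 15 7 [7, 21, 35] _ (by norm_num) (by norm_num) (by decide) s2
  have s4 := key 105 11 [11, 231] _ (by norm_num) (by norm_num) (by decide) s3
  have s5 := key 1155 13 [13, 143, 195] _ (by norm_num) (by norm_num) (by decide) s4
  revert s5
  rw [show 1155 * 13 = 15015 from rfl]
  generalize p % 15015 = ρ
  revert ρ
  decide +kernel

/-- No odd modulus `k ≤ 16 √p` has a multiple `m * p + σ` with `m / k` well inside `(1/4, 1/2)`. -/
def NoQuarterMultiple (p σ : ℤ) : Prop :=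
  ∀ k m : ℤ, Odd k → 3 ≤ k → k ^ 2 ≤ 256 * p → k ∣ m * p + σ →
    k ≤ 100 * (4 * m - k) → k ≤ 40 * (k - 2 * m) → False

lemma NoQuarterMultiple.false_of_dvd {p σ : ℤ} (H : NoQuarterMultiple p σ)
    {l L A r x g c : ℤ} (hl : l = 5 ∨ l = 7) (hL : Odd L) (hLl : l ≤ L)
    (hr : Odd r) (hr1 : 1 ≤ r) (hrA : r ∣ A) (hrl : IsCoprime r l)
    (hg : g = 1 ∨ g = 2 ∨ g = 4) (hc : c = 1 ∨ c = -1)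
    (hP : p + c * g * σ = L * A) (hx : l ∣ x * p * r + c * A) (hgx : g ∣ L * r * x + c)
    (hx1 : g * l < 4 * x) (hx2 : 2 * x < g * l) (hY : (L * l * r) ^ 2 ≤ 256 * p) : False := by
  obtain ⟨m, hm⟩ := hgx
  have hl' : Odd l := by rcases hl with rfl | rfl <;> decide
  have hkodd : Odd (L * l * r) := (hL.mul hl').mul hr
  have hn : l ≤ L * r :=
    hLl.trans (le_mul_of_one_le_right (by rcases hl with rfl | rfl <;> omega) hr1)
  refine H (L * l * r) m hkodd (by rcases hl with rfl | rfl <;> nlinarith) hY ?_ ?_ ?_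
  · have hcop : IsCoprime (L * l * r) g := by
      have h2 : IsCoprime (L * l * r) 2 := by
        obtain ⟨t, ht⟩ := hkodd
        exact ⟨1, -t, by linear_combination ht⟩
      rcases hg with rfl | rfl | rfl
      · exact isCoprime_one_right
      · exact h2
      · exact (h2.mul_right h2)
    refine hcop.dvd_of_dvd_mul_left ?_
    have h1 : l * r ∣ x * p * r + c * A := by
      refine (hrl.symm).mul_dvd hx ?_
      exact dvd_add (dvd_mul_left _ _) (hrA.mul_left c)
    have h2 : g * (m * p + σ) = L * (x * p * r + c * A) := by
      have hc2 : c * c = 1 := by rcases hc with rfl | rfl <;> rfl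
      linear_combination (-p) * hm + (c) * hP - g * σ * hc2
    rw [h2, mul_assoc]
    exact mul_dvd_mul_left L h1
  · have : L * r * (g * l + 1) ≤ L * r * (4 * x) := by
      apply mul_le_mul_of_nonneg_left (by omega)
      rcases hl with rfl | rfl <;> omega
    rcases hl with rfl | rfl <;> rcases hg with rfl | rfl | rfl <;> rcases hc with rfl | rfl <;>
      linarith
  · have : L * r * (2 * x + 1) ≤ L * r * (g * l) := by
      apply mul_le_mul_of_nonneg_left (by omega)
      rcases hl with rfl | rfl <;> omega
    rcases hl with rfl | rfl <;> rcases hg with rfl | rfl | rfl <;> rcases hc with rfl | rfl <;>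
      linarith

lemma NoQuarterMultiple.lt_sq_of_pow_dvd {p σ : ℤ} (H : NoQuarterMultiple p σ)
    {l g c : ℤ} (hl : l = 5 ∨ l = 7) (hg : g = 1 ∨ g = 2 ∨ g = 4) (hc : c = 1 ∨ c = -1)
    {R : ℤ} {S : List ℤ}
    (hS : ∀ r ∈ S, r % 2 = 1 ∧ 1 ≤ r ∧ r ≤ R ∧ r ∣ 15015 ∧ Int.gcd r l = 1)
    (hfin : ∀ a ∈ List.range 7, (a : ℤ) < l → a ≠ 0 → ∀ e ∈ [(1 : ℤ), 3], ∃ r ∈ S,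
      ∃ x ∈ List.range 14, l ∣ x * (-c * g * σ) * r + c * a ∧ g ∣ e * r * x + c ∧
        g * l < 4 * x ∧ 2 * x < g * l)
    {n : ℕ} {A : ℤ} (hn : n ≠ 0) (hP : p + c * g * σ = l ^ n * A) (hA : ¬ l ∣ A)
    (hd : 15015 ∣ p + c * g * σ) : 256 * p < (l ^ n * l * R) ^ 2 := by
  have hl0 : 5 ≤ l ∧ l ≤ 7 := by omega
  have hlodd : Odd l := by rcases hl with rfl | rfl <;> decide
  have hL : Odd (l ^ n) := hlodd.pow
  have hlL : l ≤ l ^ n := le_self_pow₀ (by omega) hn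
  have hal := Int.emod_nonneg A (b := l) (by omega)
  have hal' := Int.emod_lt_of_pos A (b := l) (by omega)
  have he : l ^ n % 4 = 1 ∨ l ^ n % 4 = 3 := by
    have := Int.odd_iff.1 hL
    omega
  obtain ⟨r, hr, x, -, h1, h2, h3, h4⟩ := hfin (A % l).toNat (List.mem_range.2 (by omega))
    (by omega) (fun h0 => hA (Int.dvd_of_emod_eq_zero (by omega))) (l ^ n % 4)
    (by rcases he with h | h <;> simp [h])
  obtain ⟨hr2, hr1, hrR, hrd, hrl⟩ := hS r hr
  have hrl' : IsCoprime r l := Int.isCoprime_iff_gcd_eq_one.2 hrl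
  by_contra! hlt
  refine H.false_of_dvd (x := x) hl hL hlL (Int.odd_iff.2 hr2) hr1 ?_ hrl' hg hc hP ?_ ?_ h3 h4 ?_
  · exact (hrl'.pow_right (n := n)).dvd_of_dvd_mul_left (hP ▸ hrd.trans hd)
  · rw [Int.toNat_of_nonneg hal] at h1
    have hlP : l ∣ p + c * g * σ := hP ▸ (dvd_pow_self l hn).mul_right A
    have h5 : l ∣ A - A % l := Int.dvd_self_sub_emod
    have : x * p * r + c * A = (x * (-c * g * σ) * r + c * (A % l)) + x * r * (p + c * g * σ)
        + c * (A - A % l) := by ring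
    rw [this]
    exact (h1.add (hlP.mul_left _)).add (h5.mul_left _)
  · have hg4 : g ∣ 4 := by rcases hg with rfl | rfl | rfl <;> decide
    have h5 : g ∣ l ^ n - l ^ n % 4 := hg4.trans Int.dvd_self_sub_emod
    have : l ^ n * r * x + c = (l ^ n % 4 * r * x + c) + (l ^ n - l ^ n % 4) * (r * x) := by ring
    rw [this]
    exact h2.add (h5.mul_right _)
  · have hLl : 0 ≤ l ^ n * l := by nlinarith
    exact (pow_le_pow_left₀ (mul_nonneg hLl (by omega))
      (mul_le_mul_of_nonneg_left hrR hLl) 2).trans hlt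

lemma NoQuarterMultiple.not_dvd {p σ g c : ℤ} (H : NoQuarterMultiple p σ) (hp : 100 ≤ p)
    (hσ : σ = 2 ∨ σ = -2) (hgc : (g = 1 ∧ c = -1) ∨ (g = 2 ∧ c = 1) ∨ (g = 4 ∧ c = -1)) :
    ¬ 15015 ∣ p + c * g * σ := by
  intro hd
  have hg : g = 1 ∨ g = 2 ∨ g = 4 := by omega
  have hc : c = 1 ∨ c = -1 := by omega
  have hP : 0 < p + c * g * σ ∧ p + c * g * σ ≤ p + 8 := by
    rcases hgc with ⟨rfl, rfl⟩ | ⟨rfl, rfl⟩ | ⟨rfl, rfl⟩ <;> omega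
  have hf5 : FiniteMultiplicity 5 (p + c * g * σ) :=
    Int.finiteMultiplicity_iff.2 ⟨by decide, hP.1.ne'⟩
  have hf7 : FiniteMultiplicity 7 (p + c * g * σ) :=
    Int.finiteMultiplicity_iff.2 ⟨by decide, hP.1.ne'⟩
  obtain ⟨A, hA, hA5⟩ := hf5.exists_eq_pow_mul_and_not_dvd
  obtain ⟨B, hB, hB7⟩ := hf7.exists_eq_pow_mul_and_not_dvd
  generalize multiplicity 5 (p + c * g * σ) = a at hA
  generalize multiplicity 7 (p + c * g * σ) = b at hB
  have ha : a ≠ 0 := by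
    rintro rfl
    rw [pow_zero, one_mul] at hA
    exact hA5 (hA ▸ dvd_trans (by norm_num) hd)
  have hb : b ≠ 0 := by
    rintro rfl
    rw [pow_zero, one_mul] at hB
    exact hB7 (hB ▸ dvd_trans (by norm_num) hd)
  have h5 := H.lt_sq_of_pow_dvd (l := 5) (R := 39) (S := [1, 3, 7, 11, 13, 21, 33, 39]) (Or.inl rfl)
    hg hc (by decide) (by
      rcases hgc with ⟨rfl, rfl⟩ | ⟨rfl, rfl⟩ | ⟨rfl, rfl⟩ <;> rcases hσ with rfl | rfl <;>
        decide +kernel) ha hA hA5 hd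
  have h7 := H.lt_sq_of_pow_dvd (l := 7) (R := 65) (S := [1, 3, 5, 11, 13, 15, 33, 39, 55, 65])
    (Or.inr rfl) hg hc (by decide) (by
      rcases hgc with ⟨rfl, rfl⟩ | ⟨rfl, rfl⟩ | ⟨rfl, rfl⟩ <;> rcases hσ with rfl | rfl <;>
        decide +kernel) hb hB hB7 hd
  have hc57 : IsCoprime ((5 : ℤ) ^ a) (7 ^ b) :=
    IsCoprime.pow (Int.isCoprime_iff_gcd_eq_one.2 (by decide))
  have hc429 : IsCoprime ((5 : ℤ) ^ a * 7 ^ b) 429 :=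
    IsCoprime.mul_left (IsCoprime.pow_left (Int.isCoprime_iff_gcd_eq_one.2 (by decide)))
      (IsCoprime.pow_left (Int.isCoprime_iff_gcd_eq_one.2 (by decide)))
  have hdvd : (5 : ℤ) ^ a * 7 ^ b * 429 ∣ p + c * g * σ :=
    hc429.mul_dvd (hc57.mul_dvd ⟨A, hA⟩ ⟨B, hB⟩) (dvd_trans (by norm_num) hd)
  have hle := Int.le_of_dvd hP.1 hdvd
  have hpos : (0 : ℤ) < 5 ^ a * 7 ^ b := by positivity
  have hsq : (256 * p) ^ 2 < (5 ^ a * 7 ^ b * 88725) ^ 2 :=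
    calc (256 * p) ^ 2 = 256 * p * (256 * p) := by ring
      _ < (5 ^ a * 5 * 39) ^ 2 * (7 ^ b * 7 * 65) ^ 2 := by
        exact mul_lt_mul'' h5 h7 (by omega) (by omega)
      _ = _ := by ring
  have := lt_of_pow_lt_pow_left₀ 2 (by positivity) hsq
  omega

lemma exists_mem_Bminus {p : ℕ} (hp : p.Prime) (hlarge : 2 ^ 22 ≤ p) :
    ∃ k b : ℕ, p = k + 2 * b ∧ k ^ 2 ≤ 256 * p ∧ b ∈ Bminus p := by
  by_contra! hno
  have hodd : Odd p := hp.odd_of_ne_two (by omega)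
  have hpZ : (2 ^ 22 : ℤ) ≤ p := by exact_mod_cast hlarge
  have key : ∀ (k : ℕ) (m : ℤ), Odd k → 3 ≤ k → k ^ 2 ≤ 256 * p → (k : ℤ) ∣ m * p - 2 →
      (k : ℤ) ^ 2 + 8 ≤ p * (4 * m - k) → (k : ℤ) ^ 2 ≤ p * (k - 2 * m) → False := by
    intro k m hk hk3 hkp hd h1 h2
    have hle : k ≤ p := by
      by_contra! hlt
      nlinarith
    obtain ⟨b, hb⟩ := (Nat.Odd.sub_odd hodd hk).exists_two_nsmul
    have hpk : p = k + 2 * b := by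
      rw [smul_eq_mul] at hb
      omega
    exact hno k b hpk hkp (mem_Bminus_of_dvd hp hpk hk3 hodd hd h1 h2)
  have H : NoQuarterMultiple p (-2) := by
    intro k m hk hk3 hkp hd h1 h2
    lift k to ℕ using by omega
    have hpk : 128 * (k : ℤ) ≤ p := by
      by_contra! hlt
      nlinarith
    have e0 : (128 : ℤ) * k ^ 2 ≤ p * k := by nlinarith
    have e1 : (p : ℤ) * k ≤ p * (100 * (4 * m - k)) := by gcongr
    have e2 : (p : ℤ) * k ≤ p * (40 * (k - 2 * m)) := by gcongr
    have e3 : (p : ℤ) * 1 ≤ p * (4 * m - k) := by gcongr; omega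
    exact key k m (by exact_mod_cast hk) (by omega) (by exact_mod_cast hkp) hd (by linarith)
      (by nlinarith)
  rcases mod_eq_of_forall_not_mem_quarter hp (by omega) fun k u hk3 hk hkodd h1 h2 hu => by
    have hd : (k : ℤ) ∣ u * p - 2 := by
      have := Int.dvd_self_sub_emod (x := (u * p : ℤ)) (m := k)
      rwa [show (u * p : ℤ) % k = 2 by exact_mod_cast hu] at this
    have hk2 : (k : ℤ) ^ 2 + 8 ≤ p := by
      have : (k : ℤ) ≤ 2047 := by exact_mod_cast hk
      nlinarith
    have e1 : (p : ℤ) * 1 ≤ p * (4 * u - k) := by gcongr; omega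
    have e2 : (p : ℤ) * 1 ≤ p * (k - 2 * u) := by gcongr; omega
    exact key k u hkodd hk3 (by zify; linarith) hd (by linarith) (by linarith) with h | h | h
  · exact H.not_dvd (g := 1) (c := -1) (by omega) (by omega) (by omega) (by omega)
  · exact H.not_dvd (g := 2) (c := 1) (by omega) (by omega) (by omega) (by omega)
  · exact H.not_dvd (g := 4) (c := -1) (by omega) (by omega) (by omega) (by omega)

lemma exists_mem_Bplus {p : ℕ} (hp : p.Prime) (hlarge : 2 ^ 20 ≤ p) :
    ∃ k b : ℕ, p = k + 2 * b ∧ k ^ 2 ≤ 256 * p ∧ b ∈ Bplus p := by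
  by_contra! hno
  have hodd : Odd p := hp.odd_of_ne_two (by omega)
  have hpZ : (2 ^ 20 : ℤ) ≤ p := by exact_mod_cast hlarge
  have key : ∀ (k : ℕ) (m : ℤ), Odd k → 3 ≤ k → k ^ 2 ≤ 256 * p → (k : ℤ) ∣ m * p + 2 →
      (k : ℤ) ^ 2 ≤ p * m → (k : ℤ) ^ 2 + 4 ≤ p * (k - 2 * m) → False := by
    intro k m hk hk3 hkp hd h1 h2
    have hle : k ≤ p := by
      by_contra! hlt
      nlinarith
    obtain ⟨b, hb⟩ := (Nat.Odd.sub_odd hodd hk).exists_two_nsmul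
    have hpk : p = k + 2 * b := by
      rw [smul_eq_mul] at hb
      omega
    exact hno k b hpk hkp (mem_Bplus_of_dvd hp hpk hk3 hodd hd h1 h2)
  have H : NoQuarterMultiple p 2 := by
    intro k m hk hk3 hkp hd h1 h2
    lift k to ℕ using by omega
    have hpk : 64 * (k : ℤ) ≤ p := by
      by_contra! hlt
      nlinarith
    have e0 : (64 : ℤ) * k ^ 2 ≤ p * k := by nlinarith
    have e1 : (p : ℤ) * k ≤ p * (4 * m) := by gcongr; omega
    have e2 : (p : ℤ) * k ≤ p * (40 * (k - 2 * m)) := by gcongr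
    have e3 : (p : ℤ) * 1 ≤ p * (k - 2 * m) := by gcongr; omega
    exact key k m (by exact_mod_cast hk) (by omega) (by exact_mod_cast hkp) hd (by nlinarith)
      (by linarith)
  rcases mod_eq_of_forall_not_mem_half hp (by omega) fun k u hk3 hk hkodd h1 h2 hu => by
    have hd : (k : ℤ) ∣ (k - u) * p + 2 := by
      have := Int.dvd_self_sub_emod (x := (u * p : ℤ)) (m := k)
      rw [show (u * p : ℤ) % k = 2 by exact_mod_cast hu] at this
      rw [show ((k - u) * p + 2 : ℤ) = k * p - (u * p - 2) by ring]
      exact (dvd_mul_right _ _).sub this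
    have hk2 : (k : ℤ) ^ 2 + 4 ≤ p := by
      have : (k : ℤ) ≤ 1000 := by exact_mod_cast hk
      nlinarith
    have e1 : (p : ℤ) * 1 ≤ p * (k - u) := by gcongr; omega
    have e2 : (p : ℤ) * 1 ≤ p * (k - 2 * (k - u)) := by gcongr; omega
    exact key k (k - u) hkodd hk3 (by zify; linarith) hd (by linarith) (by linarith) with h | h
  · exact H.not_dvd (g := 1) (c := -1) (by omega) (by omega) (by omega) (by omega)
  · exact H.not_dvd (g := 2) (c := 1) (by omega) (by omega) (by omega) (by omega)

lemma sqrt_le_mul_log_sq_of_lt {C x : ℝ} {m n : ℕ} (hC : 0 ≤ C) (hm : 2 ^ m ≤ x) (hn : x < 2 ^ n)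
    (h : (2 : ℝ) ^ n ≤ (C * (m * 0.693) ^ 2) ^ 2) : √x ≤ C * Real.log x ^ 2 := by
  have hlog : (m : ℝ) * 0.693 ≤ Real.log x := by
    have h1 : Real.log ((2 : ℝ) ^ m) ≤ Real.log x := Real.log_le_log (by positivity) hm
    rw [Real.log_pow] at h1
    have h2 := Real.log_two_gt_d9
    exact (mul_le_mul_of_nonneg_left (by linarith) (Nat.cast_nonneg m)).trans h1
  calc √x ≤ C * (m * 0.693) ^ 2 := Real.sqrt_le_iff.2 ⟨by positivity, hn.le.trans h⟩
    _ ≤ C * Real.log x ^ 2 := by gcongr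

lemma sqrt_le_six_mul_log_sq {x : ℝ} (h1 : 2 ≤ x) (h2 : x < 2 ^ 20) :
    √x ≤ 6 * Real.log x ^ 2 := by
  rcases lt_or_ge x (2 ^ 3) with h | h
  · exact sqrt_le_mul_log_sq_of_lt (m := 1) (by norm_num) (by simpa using h1) h (by norm_num)
  rcases lt_or_ge x (2 ^ 9) with h' | h'
  · exact sqrt_le_mul_log_sq_of_lt (by norm_num) h h' (by norm_num)
  rcases lt_or_ge x (2 ^ 15) with h | h
  · exact sqrt_le_mul_log_sq_of_lt (by norm_num) h' h (by norm_num)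
  rcases lt_or_ge x (2 ^ 18) with h' | h'
  · exact sqrt_le_mul_log_sq_of_lt (by norm_num) h h' (by norm_num)
  rcases lt_or_ge x (2 ^ 19) with h | h
  · exact sqrt_le_mul_log_sq_of_lt (by norm_num) h' h (by norm_num)
  · exact sqrt_le_mul_log_sq_of_lt (by norm_num) h h2 (by norm_num)

lemma sqrt_le_twelve_mul_log_sq {x : ℝ} (h1 : 2 ≤ x) (h2 : x < 2 ^ 22) :
    √x ≤ 12 * Real.log x ^ 2 := by
  rcases lt_or_ge x (2 ^ 5) with h | h
  · exact sqrt_le_mul_log_sq_of_lt (m := 1) (by norm_num) (by simpa using h1) h (by norm_num)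
  rcases lt_or_ge x (2 ^ 14) with h' | h'
  · exact sqrt_le_mul_log_sq_of_lt (by norm_num) h h' (by norm_num)
  rcases lt_or_ge x (2 ^ 20) with h | h
  · exact sqrt_le_mul_log_sq_of_lt (by norm_num) h' h (by norm_num)
  · exact sqrt_le_mul_log_sq_of_lt (by norm_num) h h2 (by norm_num)

lemma half_sub_le_of_sqrt_le {x c b : ℝ} (hx : 0 ≤ x) (hb : 0 ≤ b)
    (h : √x ≤ 2 * c * Real.log x ^ 2) : x / 2 - c * √x * Real.log x ^ 2 ≤ b := by
  nlinarith [mul_le_mul_of_nonneg_left h (Real.sqrt_nonneg x), Real.mul_self_sqrt hx]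

lemma half_sub_le_of_eq_add {p k b : ℕ} {c : ℝ} (hc : 3 ≤ c) (hp : 2 ^ 20 ≤ p)
    (hpk : p = k + 2 * b) (hk : k ^ 2 ≤ 256 * p) :
    (p : ℝ) / 2 - c * √p * Real.log p ^ 2 ≤ b := by
  have hk' : (k : ℝ) ≤ 16 * √p := by
    have h1 : ((k : ℝ)) ^ 2 ≤ (16 * √p) ^ 2 := by
      rw [mul_pow, Real.sq_sqrt (Nat.cast_nonneg p)]
      norm_num
      exact_mod_cast hk
    exact le_of_sq_le_sq h1 (by positivity)
  have hp' : (2 : ℝ) ^ 20 ≤ p := by exact_mod_cast hp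
  have hlog : 2 ≤ Real.log p := by
    have h1 := Real.log_le_log (by positivity) hp'
    rw [Real.log_pow] at h1
    have h2 := Real.log_two_gt_d9
    push_cast at h1
    linarith
  have h8 : 8 ≤ c * Real.log p ^ 2 := by nlinarith
  have hpk' : (p : ℝ) = k + 2 * b := by exact_mod_cast hpk
  nlinarith [mul_le_mul_of_nonneg_left h8 (Real.sqrt_nonneg p)]

theorem stmt_17 (p : ℕ) (hp : p.Prime) :
    (∀ β ∈ Bminus p, (β : ℝ) ≤ (p : ℝ) / 2) ∧
    (∀ β ∈ Bplus p, (β : ℝ) ≤ (p : ℝ) / 2) ∧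
    (∀ hne : (Bplus p).Nonempty,
      (p : ℝ) / 2 - 3 * Real.sqrt p * (Real.log p) ^ 2 ≤ (((Bplus p).max' hne : ℕ) : ℝ)) ∧
    (∀ hne : (Bminus p).Nonempty,
      (p : ℝ) / 2 - 6 * Real.sqrt p * (Real.log p) ^ 2 ≤ (((Bminus p).max' hne : ℕ) : ℝ)) := by
  have hp2 : (2 : ℝ) ≤ p := by exact_mod_cast hp.two_le
  refine ⟨fun β hβ => ?_, fun β hβ => ?_, fun hne => ?_, fun hne => ?_⟩
  · have h : 2 * β + 3 ≤ p := (Finset.mem_filter.1 hβ).2.1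
    have : (2 : ℝ) * β + 3 ≤ p := by exact_mod_cast h
    linarith
  · have h : 2 * β + 3 ≤ p := (Finset.mem_filter.1 hβ).2.1
    have : (2 : ℝ) * β + 3 ≤ p := by exact_mod_cast h
    linarith
  · rcases lt_or_ge p (2 ^ 20) with hs | hl
    · refine half_sub_le_of_sqrt_le (by positivity) (by positivity) ?_
      norm_num only
      exact sqrt_le_six_mul_log_sq hp2 (by exact_mod_cast hs)
    · obtain ⟨k, b, hpk, hk, hb⟩ := exists_mem_Bplus hp hl
      refine (half_sub_le_of_eq_add le_rfl hl hpk hk).trans ?_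
      exact_mod_cast Finset.le_max' _ _ hb
  · rcases lt_or_ge p (2 ^ 22) with hs | hl
    · refine half_sub_le_of_sqrt_le (by positivity) (by positivity) ?_
      norm_num only
      exact sqrt_le_twelve_mul_log_sq hp2 (by exact_mod_cast hs)
    · obtain ⟨k, b, hpk, hk, hb⟩ := exists_mem_Bminus hp hl
      refine (half_sub_le_of_eq_add (by norm_num) (le_trans (by norm_num) hl) hpk hk).trans ?_
      exact_mod_cast Finset.le_max' _ _ hb
end
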